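/- arXiv:1805.05261 — 3 statements merged into one kernel-verified Lean document; each statement's English description precedes it below -/
import Mathlib

section
/- Let Γ be a free group of rank r ≥ 1 with free generating set {a₁,…,a_r}, let S = {a₁^{±1},…,a_r^{±1}} and q = 2r−1. For n ∈ ℕ let S_n be the set of elements of Γ of word length exactly n with respect to S, and let A_n be the bounded operator on ℓ²(Γ) defined by (A_n f)(x) = (1/|S_n|) Σ_{γ∈S_n} f(xγ). Then the operator norm of A_n equals (1 + ((q−1)/(q+1))·n)·q^{−n/2}. -/
open MeasureTheory

noncomputable section

/-- Products of `n` elements of `S`. -/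
def wordProds {G : Type*} [Monoid G] (S : Set G) (n : ℕ) : Set G :=
  { g | ∃ w : Fin n → G, (∀ i, w i ∈ S) ∧ (List.ofFn w).prod = g }

/-- The sphere of radius `n` around the identity for the word metric defined by the
symmetric set `S`: the elements of word length exactly `n`. -/
def wordSphere {G : Type*} [Monoid G] (S : Set G) (n : ℕ) : Set G :=
  wordProds S n \ ⋃ k ∈ Finset.range n, wordProds S k

/-- The ball of radius `n` around the identity for the word metric defined by `S`:
the elements of word length at most `n`. -/
def wordBall {G : Type*} [Monoid G] (S : Set G) (n : ℕ) : Set G :=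
  ⋃ k ∈ Finset.range (n + 1), wordSphere S k

/-- The symmetric generating set `S = {a₁^{±1}, …, a_r^{±1}}` of the free group of
rank `r`, where `a₁, …, a_r` is the standard free generating set. -/
def freeGens (r : ℕ) : Set (FreeGroup (Fin r)) :=
  { g | ∃ i : Fin r, g = FreeGroup.of i ∨ g = (FreeGroup.of i)⁻¹ }

/-- The `ℓ²`-norm of a function on a group. -/
def l2Norm {Γ : Type*} (f : Γ → ℂ) : ℝ := Real.sqrt (∑' γ, ‖f γ‖ ^ 2)

namespace SphNorm

/-- A letter as an element of the free group. -/
def letter {r : ℕ} (p : Fin r × Bool) : FreeGroup (Fin r) := FreeGroup.mk [p]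

/-- The inverse letter. -/
def flipL {r : ℕ} (p : Fin r × Bool) : Fin r × Bool := (p.1, !p.2)

lemma flipL_flipL {r : ℕ} (p : Fin r × Bool) : flipL (flipL p) = p := by
  simp [flipL]

lemma letter_flip {r : ℕ} (p : Fin r × Bool) : letter (flipL p) = (letter p)⁻¹ := by
  simp [letter, flipL, FreeGroup.inv_mk, FreeGroup.invRev]

lemma norm_letter {r : ℕ} (p : Fin r × Bool) : (letter p).norm = 1 := by
  have h : FreeGroup.IsReduced [p] := FreeGroup.IsReduced.singleton
  simp [letter, FreeGroup.norm, FreeGroup.toWord_mk, h.reduce_eq]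

lemma exists_back {r : ℕ} (x : FreeGroup (Fin r)) (hx : x ≠ 1) :
    ∃ p₀ : Fin r × Bool, (x * letter p₀).norm + 1 = x.norm ∧
      ∀ p, p ≠ p₀ → (x * letter p).norm = x.norm + 1 := by
  rcases List.eq_nil_or_concat x.toWord with h | ⟨L, c, h⟩
  · exact absurd (FreeGroup.toWord_eq_nil_iff.1 h) hx
  · have hred : FreeGroup.IsReduced (L ++ [c]) := by
      have := FreeGroup.isReduced_toWord (x := x)
      rw [h] at this; simpa using this
    have hxe : x = FreeGroup.mk (L ++ [c]) := by
      rw [← FreeGroup.mk_toWord (x := x), h]; simp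
    have hn : x.norm = L.length + 1 := by simp [FreeGroup.norm, h]
    refine ⟨flipL c, ?_, ?_⟩
    · have e : x * letter (flipL c) = FreeGroup.mk L := by
        rw [letter_flip, hxe, ← FreeGroup.mul_mk, letter, mul_assoc, mul_inv_cancel, mul_one]
      have hL : FreeGroup.IsReduced L := hred.infix ⟨[], [c], by simp⟩
      rw [e, hn]
      simp [FreeGroup.norm, FreeGroup.toWord_mk, hL.reduce_eq]
    · intro p hp
      have h2 : FreeGroup.IsReduced ([c] ++ [p]) := by
        simp only [List.cons_append, List.nil_append, FreeGroup.IsReduced, List.isChain_cons_cons]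
        refine ⟨fun h1 => ?_, List.isChain_singleton _⟩
        by_contra h3
        apply hp
        ext1
        · exact h1.symm
        · simp only [flipL]
          revert h3; cases c.2 <;> cases p.2 <;> simp
      have h3 := FreeGroup.IsReduced.append_overlap hred h2 (by simp)
      have e : x * letter p = FreeGroup.mk (L ++ [c] ++ [p]) := by
        rw [hxe]; simp [letter]
      rw [e, hn, FreeGroup.norm, FreeGroup.toWord_mk, h3.reduce_eq]
      simp

lemma norm_step {r : ℕ} (x : FreeGroup (Fin r)) (p : Fin r × Bool) :
    (x * letter p).norm + 1 = x.norm ∨ (x * letter p).norm = x.norm + 1 := by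
  by_cases hx : x = 1
  · subst hx; right; simp [norm_letter]
  · obtain ⟨p₀, h1, h2⟩ := exists_back x hx
    by_cases hp : p = p₀
    · subst hp; exact Or.inl h1
    · exact Or.inr (h2 p hp)

lemma mem_wordProds {r : ℕ} (x : FreeGroup (Fin r)) : x ∈ wordProds (freeGens r) x.norm := by
  refine ⟨fun i => letter (x.toWord.get i), fun i => ?_, ?_⟩
  · show letter (x.toWord.get i) ∈ freeGens r
    generalize x.toWord.get i = p
    obtain ⟨a, b⟩ := p
    refine ⟨a, ?_⟩
    cases b
    · right; simp [letter, FreeGroup.of, FreeGroup.inv_mk, FreeGroup.invRev]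
    · left; rfl
  · have : List.ofFn (fun i : Fin x.norm => letter (x.toWord.get i)) = x.toWord.map letter := by
      have := List.ofFn_get (x.toWord.map letter)
      simp [FreeGroup.norm]
    rw [this]
    have h : ∀ L : List (Fin r × Bool), (L.map letter).prod = FreeGroup.mk L := by
      intro L
      induction L with
      | nil => rfl
      | cons a L ih => rw [List.map_cons, List.prod_cons, ih]; simp [letter]
    rw [h, FreeGroup.mk_toWord]

lemma norm_le_of_mem {r k : ℕ} (x : FreeGroup (Fin r)) (h : x ∈ wordProds (freeGens r) k) :
    x.norm ≤ k := by
  obtain ⟨w, hw, rfl⟩ := h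
  have H : ∀ L : List (FreeGroup (Fin r)), (∀ g ∈ L, g ∈ freeGens r) → L.prod.norm ≤ L.length := by
    intro L
    induction L with
    | nil => simp
    | cons a L ih =>
      intro h
      have h1 := ih (fun g hg => h g (by simp [hg]))
      have h2 : a.norm = 1 := by
        obtain ⟨i, hi | hi⟩ := h a (by simp)
        · rw [hi]; simp
        · rw [hi, FreeGroup.norm_inv_eq]; simp
      have := FreeGroup.norm_mul_le a L.prod
      simp only [List.prod_cons, List.length_cons]; omega
  have := H (List.ofFn w) (by simpa [List.mem_ofFn] using hw)
  simpa using this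

lemma mem_wordSphere {r n : ℕ} (x : FreeGroup (Fin r)) :
    x ∈ wordSphere (freeGens r) n ↔ x.norm = n := by
  simp only [wordSphere, Set.mem_sdiff, Set.mem_iUnion, Finset.mem_range, not_exists]
  constructor
  · rintro ⟨h1, h2⟩
    have := norm_le_of_mem x h1
    by_contra h3
    exact h2 x.norm (by omega) (mem_wordProds x)
  · rintro rfl
    refine ⟨mem_wordProds x, fun k hk h => ?_⟩
    have := norm_le_of_mem x h
    omega

lemma finite_sph (r n : ℕ) : {x : FreeGroup (Fin r) | x.norm = n}.Finite := by
  have : (FreeGroup.toWord '' {x : FreeGroup (Fin r) | x.norm = n}).Finite := by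
    refine (List.finite_length_eq (Fin r × Bool) n).subset ?_
    rintro _ ⟨x, hx, rfl⟩
    exact hx
  exact this.of_finite_image (FreeGroup.toWord_injective.injOn)

/-- The sphere as a finset. -/
def sph (r n : ℕ) : Finset (FreeGroup (Fin r)) := (finite_sph r n).toFinset

lemma mem_sph {r n : ℕ} {x : FreeGroup (Fin r)} : x ∈ sph r n ↔ x.norm = n := by
  simp [sph]

lemma sph_zero (r : ℕ) : sph r 0 = {1} := by
  ext x; simp [mem_sph]

lemma sum_nbr {r m : ℕ} (x : FreeGroup (Fin r)) (φ : ℕ → ℝ) (hx : x.norm = m + 1) :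
    ∑ p, φ ((x * letter p).norm) = φ m + (2 * (r : ℝ) - 1) * φ (m + 2) := by
  obtain ⟨p₀, h1, h2⟩ := exists_back x (by rintro rfl; simp at hx)
  rw [← Finset.add_sum_erase _ _ (Finset.mem_univ p₀)]
  have e : (x * letter p₀).norm = m := by omega
  rw [e, Finset.sum_congr rfl (g := fun _ => φ (m + 2))]
  · have hc : 0 < Fintype.card (Fin r × Bool) := Fintype.card_pos_iff.2 ⟨p₀⟩
    rw [Finset.sum_const, Finset.card_erase_of_mem (Finset.mem_univ _), nsmul_eq_mul,
      Finset.card_univ, Nat.cast_sub hc]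
    simp; left; ring
  · intro p hp
    rw [h2 p (Finset.ne_of_mem_erase hp), hx]

lemma sum_nbr_one {r : ℕ} (φ : ℕ → ℝ) :
    ∑ p : Fin r × Bool, φ (((1 : FreeGroup (Fin r)) * letter p).norm) = 2 * (r : ℝ) * φ 1 := by
  simp [norm_letter]; left; ring

lemma sum_flip {r : ℕ} (g : Fin r × Bool → ℝ) : ∑ p, g (flipL p) = ∑ p, g p :=
  Equiv.sum_comp (⟨flipL, flipL, flipL_flipL, flipL_flipL⟩ : (Fin r × Bool) ≃ (Fin r × Bool)) g

lemma recurrence {r : ℕ} (m : ℕ) (F : FreeGroup (Fin r) → ℝ) :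
    ∑ γ ∈ sph r (m + 1), ∑ p, F (γ * letter p) =
      ∑ γ ∈ sph r (m + 2), F γ +
        (if m = 0 then 2 * (r : ℝ) else 2 * (r : ℝ) - 1) * ∑ γ ∈ sph r m, F γ := by
  have hdis : Disjoint (sph r (m + 2)) (sph r m) := by
    rw [Finset.disjoint_left]; intro x h1 h2
    rw [mem_sph] at h1 h2; omega
  have key : ∀ p : Fin r × Bool, ∑ γ ∈ sph r (m + 1), F (γ * letter p) =
      ∑ δ ∈ sph r (m + 2) ∪ sph r m,
        if (δ * letter (flipL p)).norm = m + 1 then F δ else 0 := by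
    intro p
    rw [← Finset.sum_filter]
    refine Finset.sum_bij' (fun γ _ => γ * letter p) (fun δ _ => δ * letter (flipL p)) ?_ ?_ ?_ ?_ ?_
    · intro γ hγ
      rw [mem_sph] at hγ
      simp only [Finset.mem_filter, Finset.mem_union, mem_sph, letter_flip]
      rcases norm_step γ p with h | h
      · refine ⟨Or.inr (by omega), by simpa using hγ⟩
      · refine ⟨Or.inl (by omega), by simpa using hγ⟩
    · intro δ hδ
      rw [Finset.mem_filter] at hδ
      exact mem_sph.2 hδ.2
    · intro γ _; simp [letter_flip]
    · intro γ _; simp [letter_flip]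
    · intro γ _; rfl
  rw [Finset.sum_comm, Finset.sum_congr rfl (fun p _ => key p), Finset.sum_comm,
    Finset.sum_union hdis]
  have hsw : ∀ δ : FreeGroup (Fin r),
      (∑ p, if (δ * letter (flipL p)).norm = m + 1 then F δ else 0) =
      ∑ p, (fun k => if k = m + 1 then F δ else 0) (δ * letter p).norm := fun δ =>
    sum_flip (fun p => if (δ * letter p).norm = m + 1 then F δ else 0)
  congr 1
  · refine Finset.sum_congr rfl fun δ hδ => ?_
    rw [hsw, sum_nbr (m := m + 1) δ (fun k => if k = m + 1 then F δ else 0) (mem_sph.1 hδ)]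
    simp
  · rw [Finset.mul_sum]
    refine Finset.sum_congr rfl fun δ hδ => ?_
    rw [hsw]
    rw [mem_sph] at hδ
    rcases m with _ | m
    · rw [FreeGroup.norm_eq_zero] at hδ
      subst hδ
      rw [sum_nbr_one (fun k => if k = 0 + 1 then F 1 else 0)]; simp
    · rw [sum_nbr δ (fun k => if k = m + 1 + 1 then F δ else 0) hδ]; simp
      intro h; omega

lemma sum_sph_one {r : ℕ} (F : FreeGroup (Fin r) → ℝ) :
    ∑ γ ∈ sph r 1, F γ = ∑ p, F (letter p) := by
  symm
  refine Finset.sum_bij (fun p _ => letter p) ?_ ?_ ?_ ?_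
  · intro p _; exact mem_sph.2 (norm_letter p)
  · intro p _ p' _ h
    have h2 : ∀ p : Fin r × Bool, (letter p).toWord = [p] := by
      intro p
      have h : FreeGroup.IsReduced [p] := FreeGroup.IsReduced.singleton
      simp [letter, FreeGroup.toWord_mk, h.reduce_eq]
    have := congrArg FreeGroup.toWord h
    rw [h2, h2] at this
    simpa using this
  · intro γ hγ
    rw [mem_sph, FreeGroup.norm, List.length_eq_one_iff] at hγ
    obtain ⟨p, hp⟩ := hγ
    exact ⟨p, Finset.mem_univ _, by rw [letter, ← hp, FreeGroup.mk_toWord]⟩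
  · intro _ _; rfl

/-- Generic two-step recurrence for sphere sums of a local eigenfunction. -/
lemma sphere_sum {r : ℕ} (lam : ℝ) (V : ℕ → ℝ) (h0 : V 0 = 1) (h1 : V 1 = lam)
    (hV : ∀ m, V (m + 2) = lam * V (m + 1) -
      (if m = 0 then 2 * (r : ℝ) else 2 * (r : ℝ) - 1) * V m)
    (F : FreeGroup (Fin r) → ℝ) (n : ℕ)
    (hF : ∀ γ, γ.norm < n → ∑ p, F (γ * letter p) = lam * F γ) :
    ∑ γ ∈ sph r n, F γ = V n * F 1 := by
  have H : ∀ k, (k ≤ n → ∑ γ ∈ sph r k, F γ = V k * F 1) ∧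
      (k + 1 ≤ n → ∑ γ ∈ sph r (k + 1), F γ = V (k + 1) * F 1) := by
    intro k
    induction k with
    | zero =>
      refine ⟨fun _ => by simp [sph_zero, h0], fun hk => ?_⟩
      have := hF 1 (by simpa using Nat.lt_of_succ_le hk)
      simp only [one_mul] at this
      rw [sum_sph_one, this, zero_add, h1]
    | succ k ih =>
      refine ⟨ih.2, fun hk => ?_⟩
      have e := recurrence k F
      rw [Finset.sum_congr rfl (fun γ hγ => hF γ (by rw [mem_sph.1 hγ]; omega)),
        ← Finset.mul_sum, ih.2 (by omega), ih.1 (by omega)] at e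
      have : k + 1 + 1 = k + 2 := rfl
      rw [this, hV k]
      linear_combination -e
  exact (H n).1 le_rfl

/-- Unnormalised eigenvalue of the sphere operator. -/
def Vs (s : ℝ) : ℕ → ℝ
  | 0 => 1
  | m + 1 => s ^ (m + 1) * (2 + m * (s ^ 2 - 1) / s ^ 2)

/-- Cardinality of spheres. -/
def Cs (s : ℝ) : ℕ → ℝ
  | 0 => 1
  | m + 1 => (s ^ 2 + 1) * (s ^ 2) ^ m

lemma Cs_pos {s : ℝ} (hs : 0 < s) (n : ℕ) : 0 < Cs s n := by
  cases n <;> simp only [Cs] <;> positivity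

lemma Vs_eq {s : ℝ} (hs : 0 < s) (n : ℕ) :
    Vs s n = Cs s n * ((1 + (s ^ 2 - 1) / (s ^ 2 + 1) * n) * s⁻¹ ^ n) := by
  cases n with
  | zero => simp [Vs, Cs]
  | succ m =>
    have h2 : s ^ 2 + 1 ≠ 0 := by positivity
    simp only [Vs, Cs, inv_pow]
    push_cast
    field_simp
    ring

lemma sum_eig {r : ℕ} {s : ℝ} (hs : 0 < s) (hq : s ^ 2 = 2 * (r : ℝ) - 1)
    (F : FreeGroup (Fin r) → ℝ) (n : ℕ)
    (hF : ∀ γ, γ.norm < n → ∑ p, F (γ * letter p) = 2 * s * F γ) :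
    ∑ γ ∈ sph r n, F γ = Vs s n * F 1 := by
  refine sphere_sum (2 * s) (Vs s) rfl (by simp [Vs]; ring) ?_ F n hF
  intro m
  have hr : 2 * (r : ℝ) = s ^ 2 + 1 := by linarith
  rw [hr]
  rcases m with _ | m
  · simp [Vs]; field_simp; ring
  · simp [Vs]; field_simp; ring

lemma card_sph {r : ℕ} {s : ℝ} (hq : s ^ 2 = 2 * (r : ℝ) - 1) (n : ℕ) :
    ((sph r n).card : ℝ) = Cs s n := by
  have hr : 2 * (r : ℝ) = s ^ 2 + 1 := by linarith
  have := sphere_sum (r := r) (s ^ 2 + 1) (Cs s) rfl (by simp [Cs]) ?_ (fun _ => 1) n ?_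
  · simpa using this
  · intro m
    rw [hr]
    rcases m with _ | m
    · simp [Cs]; ring
    · simp [Cs]; ring
  · intro γ _
    simp
    linarith

lemma schur {G : Type*} [Group G] (Sn : Finset G) (hsym : ∀ γ ∈ Sn, γ⁻¹ ∈ Sn)
    (h : G → ℝ) (hpos : ∀ x, 0 < h x) (τ : ℝ)
    (hτ : ∀ x, ∑ γ ∈ Sn, h (x * γ) = τ * h x) (f : G → ℂ)
    (hf : Summable fun x => ‖f x‖ ^ 2) :
    Summable (fun x => ‖∑ γ ∈ Sn, f (x * γ)‖ ^ 2) ∧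
      ∑' x, ‖∑ γ ∈ Sn, f (x * γ)‖ ^ 2 ≤ τ ^ 2 * ∑' x, ‖f x‖ ^ 2 := by
  have hτ0 : 0 ≤ τ := by
    have h1 := hτ 1
    have h2 : 0 ≤ ∑ γ ∈ Sn, h (1 * γ) := Finset.sum_nonneg fun γ _ => (hpos _).le
    rw [h1] at h2
    exact nonneg_of_mul_nonneg_left h2 (hpos 1)
  have hinv : ∀ y, ∑ γ ∈ Sn, h (y * γ⁻¹) = τ * h y := by
    intro y
    rw [← hτ y]
    exact Finset.sum_bij' (fun γ _ => γ⁻¹) (fun γ _ => γ⁻¹) hsym hsym (by simp) (by simp) (by simp)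
  obtain ⟨g, hg⟩ : ∃ g : G → G → ℝ, ∀ γ y, g γ y = h (y * γ⁻¹) / h y * ‖f y‖ ^ 2 :=
    ⟨_, fun _ _ => rfl⟩
  have hg0 : ∀ γ y, 0 ≤ g γ y := fun γ y => by
    rw [hg]; exact mul_nonneg (div_nonneg (hpos _).le (hpos _).le) (by positivity)
  have hgs : ∀ γ ∈ Sn, Summable (g γ) := by
    intro γ hγ
    refine Summable.of_nonneg_of_le (hg0 γ) (fun y => ?_) (hf.mul_left τ)
    rw [hg]
    refine mul_le_mul_of_nonneg_right ?_ (by positivity)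
    rw [div_le_iff₀ (hpos y), ← hinv y]
    exact Finset.single_le_sum (f := fun γ => h (y * γ⁻¹)) (fun i _ => (hpos _).le) hγ
  have hgs' : ∀ γ ∈ Sn, Summable (fun x => g γ (x * γ)) := fun γ hγ =>
    (Equiv.mulRight γ).summable_iff.2 (hgs γ hγ)
  have hpt : ∀ x, ‖∑ γ ∈ Sn, f (x * γ)‖ ^ 2 ≤ τ * ∑ γ ∈ Sn, g γ (x * γ) := by
    intro x
    have h1 : ‖∑ γ ∈ Sn, f (x * γ)‖ ^ 2 ≤ (∑ γ ∈ Sn, ‖f (x * γ)‖) ^ 2 :=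
      pow_le_pow_left₀ (norm_nonneg _) (norm_sum_le _ _) 2
    have h2 := Finset.sum_sq_le_sum_mul_sum_of_sq_le_mul Sn (r := fun γ => ‖f (x * γ)‖)
      (f := fun γ => h (x * γ)) (g := fun γ => ‖f (x * γ)‖ ^ 2 / h (x * γ))
      (fun γ _ => (hpos _).le) (fun γ _ => div_nonneg (by positivity) (hpos _).le)
      (fun γ _ => by have := (hpos (x * γ)).ne'; apply le_of_eq; field_simp)
    refine h1.trans (h2.trans (le_of_eq ?_))
    rw [hτ, mul_assoc, Finset.mul_sum]
    congr 1
    refine Finset.sum_congr rfl fun γ _ => ?_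
    simp only [hg, mul_inv_cancel_right]
    ring
  have hS : Summable (fun x => τ * ∑ γ ∈ Sn, g γ (x * γ)) :=
    (summable_sum hgs').mul_left τ
  have hL := Summable.of_nonneg_of_le (fun x => by positivity) hpt hS
  refine ⟨hL, (hL.tsum_le_tsum hpt hS).trans (le_of_eq ?_)⟩
  have hshift : ∀ γ ∈ Sn, ∑' b, g γ (b * γ) = ∑' b, g γ b := fun γ _ =>
    (Equiv.mulRight γ).tsum_eq (g γ)
  rw [tsum_mul_left, Summable.tsum_finsetSum hgs', Finset.sum_congr rfl hshift,
    ← Summable.tsum_finsetSum hgs]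
  have : ∀ y, ∑ γ ∈ Sn, g γ y = τ * ‖f y‖ ^ 2 := by
    intro y
    simp only [hg]
    rw [← Finset.sum_mul, ← Finset.sum_div, hinv, mul_div_cancel_right₀ _ (hpos y).ne']
  simp only [this]
  rw [tsum_mul_left]
  ring

/-- The positive spherical eigenfunction. -/
def sphF {r : ℕ} (s : ℝ) (x : FreeGroup (Fin r)) : ℝ :=
  (1 + (s ^ 2 - 1) / (s ^ 2 + 1) * (x.norm : ℝ)) * s⁻¹ ^ x.norm

lemma sphF_pos {r : ℕ} {s : ℝ} (hs : 1 ≤ s) (x : FreeGroup (Fin r)) : 0 < sphF s x := by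
  have h : 0 ≤ s ^ 2 - 1 := by nlinarith
  have : 0 < s := by linarith
  unfold sphF; positivity

lemma sphF_eig {r : ℕ} {s : ℝ} (hs : 0 < s) (hq : s ^ 2 = 2 * (r : ℝ) - 1)
    (x : FreeGroup (Fin r)) : ∑ p, sphF s (x * letter p) = 2 * s * sphF s x := by
  have hr : 2 * (r : ℝ) = s ^ 2 + 1 := by linarith
  have h2 : s ^ 2 + 1 ≠ 0 := by positivity
  by_cases hx : x = 1
  · subst hx
    have := sum_nbr_one (r := r) (fun k => (1 + (s ^ 2 - 1) / (s ^ 2 + 1) * (k : ℝ)) * s⁻¹ ^ k)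
    simp only [sphF]
    rw [this, hr]
    simp
    field_simp
    ring
  · have hx' : x.norm ≠ 0 := fun h => hx (FreeGroup.norm_eq_zero.1 h)
    obtain ⟨m, hm⟩ := Nat.exists_eq_succ_of_ne_zero hx'
    have := sum_nbr x (fun k => (1 + (s ^ 2 - 1) / (s ^ 2 + 1) * (k : ℝ)) * s⁻¹ ^ k) hm
    simp only [sphF]
    rw [this, hr, hm]
    push_cast
    simp only [inv_pow, Nat.succ_eq_add_one]
    field_simp
    ring

lemma upper {r : ℕ} {s : ℝ} (hs : 1 ≤ s) (hq : s ^ 2 = 2 * (r : ℝ) - 1) (n : ℕ)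
    (f : FreeGroup (Fin r) → ℂ) (hf : Summable fun x => ‖f x‖ ^ 2) :
    Summable (fun x => ‖∑ γ ∈ sph r n, f (x * γ)‖ ^ 2) ∧
      ∑' x, ‖∑ γ ∈ sph r n, f (x * γ)‖ ^ 2 ≤ (Vs s n) ^ 2 * ∑' x, ‖f x‖ ^ 2 := by
  have hs0 : 0 < s := by linarith
  refine schur (sph r n) (fun γ hγ => ?_) (sphF s) (sphF_pos hs) (Vs s n) (fun x => ?_) f hf
  · rw [mem_sph] at *; rw [FreeGroup.norm_inv_eq, hγ]
  · have := sum_eig hs0 hq (fun γ => sphF s (x * γ)) n (fun γ _ => by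
      simpa [mul_assoc] using sphF_eig hs0 hq (x * γ))
    simpa using this

/-- Test functions. -/
def tf (r : ℕ) (s : ℝ) (N : ℕ) (x : FreeGroup (Fin r)) : ℂ :=
  if x.norm ≤ N then ((s⁻¹ ^ x.norm : ℝ) : ℂ) else 0

lemma sum_biUnion_sph {r : ℕ} {s : ℝ} (hq : s ^ 2 = 2 * (r : ℝ) - 1)
    (I : Finset ℕ) : ∑ x ∈ I.biUnion (sph r), (s⁻¹ ^ x.norm) ^ 2 =
      ∑ k ∈ I, Cs s k * (s⁻¹ ^ k) ^ 2 := by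
  rw [Finset.sum_biUnion]
  · refine Finset.sum_congr rfl fun k _ => ?_
    rw [Finset.sum_congr rfl (g := fun _ => (s⁻¹ ^ k) ^ 2) (fun x hx => by rw [mem_sph.1 hx]),
      Finset.sum_const, nsmul_eq_mul, card_sph hq]
  · intro i _ j _ hij
    simp only [Function.onFun]
    rw [Finset.disjoint_left]; intro x h1 h2
    rw [mem_sph] at h1 h2; omega

lemma Cs_mul {s : ℝ} (hs : 0 < s) (k : ℕ) :
    Cs s (k + 1) * (s⁻¹ ^ (k + 1)) ^ 2 = (s ^ 2 + 1) / s ^ 2 := by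
  simp only [Cs, inv_pow]
  field_simp
  ring

lemma tf_hasSum {r : ℕ} {s : ℝ} (hs : 0 < s) (hq : s ^ 2 = 2 * (r : ℝ) - 1) (N : ℕ) :
    HasSum (fun x => ‖tf r s N x‖ ^ 2) (1 + N * ((s ^ 2 + 1) / s ^ 2)) := by
  have e : 1 + N * ((s ^ 2 + 1) / s ^ 2) =
      ∑ x ∈ (Finset.range (N + 1)).biUnion (sph r), ‖tf r s N x‖ ^ 2 := by
    rw [Finset.sum_congr rfl (g := fun x => (s⁻¹ ^ x.norm) ^ 2), sum_biUnion_sph hq,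
      Finset.sum_range_succ', Finset.sum_congr rfl (fun k _ => Cs_mul hs k)]
    · simp [Cs]; ring
    · intro x hx
      simp only [Finset.mem_biUnion, Finset.mem_range, mem_sph] at hx
      obtain ⟨k, hk, rfl⟩ := hx
      rw [tf, if_pos (by omega), Complex.norm_real, Real.norm_of_nonneg (by positivity)]
  rw [e]
  refine hasSum_sum_of_ne_finset_zero fun x hx => ?_
  simp only [Finset.mem_biUnion, Finset.mem_range, mem_sph] at hx
  rw [tf, if_neg]
  · simp
  · intro h; exact hx ⟨x.norm, by omega, rfl⟩

lemma tf_apply {r : ℕ} {s : ℝ} (hs : 0 < s) (hq : s ^ 2 = 2 * (r : ℝ) - 1) (n N : ℕ)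
    (x : FreeGroup (Fin r)) (h1 : n ≤ x.norm) (h2 : x.norm + n ≤ N) :
    ∑ γ ∈ sph r n, tf r s N (x * γ) = ((Vs s n * s⁻¹ ^ x.norm : ℝ) : ℂ) := by
  have hr : 2 * (r : ℝ) = s ^ 2 + 1 := by linarith
  have e := sum_eig hs hq (fun γ => s⁻¹ ^ (x * γ).norm) n ?_
  · simp only [mul_one] at e
    rw [← e, Complex.ofReal_sum]
    refine Finset.sum_congr rfl fun γ hγ => ?_
    rw [tf, if_pos]
    have := FreeGroup.norm_mul_le x γ
    rw [mem_sph.1 hγ] at this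
    omega
  · intro γ hγ
    have hx' : (x * γ).norm ≠ 0 := by
      have := FreeGroup.norm_mul_le (x * γ) γ⁻¹
      rw [mul_inv_cancel_right, FreeGroup.norm_inv_eq] at this
      omega
    obtain ⟨m, hm⟩ := Nat.exists_eq_succ_of_ne_zero hx'
    have := sum_nbr (x * γ) (fun k => s⁻¹ ^ k) hm
    simp only [← mul_assoc]
    rw [this, hr, hm]
    simp only [inv_pow, Nat.succ_eq_add_one]
    field_simp
    ring

lemma lower {r : ℕ} {s : ℝ} (hs : 1 ≤ s) (hq : s ^ 2 = 2 * (r : ℝ) - 1) (n M : ℕ) :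
    (Vs s n) ^ 2 * (M * ((s ^ 2 + 1) / s ^ 2)) ≤
      ∑' x, ‖∑ γ ∈ sph r n, tf r s (2 * n + M) (x * γ)‖ ^ 2 := by
  have hs0 : 0 < s := by linarith
  have hS := (upper hs hq n (tf r s (2 * n + M)) (tf_hasSum hs0 hq _).summable).1
  refine le_trans (le_of_eq ?_) (hS.sum_le_tsum (((Finset.range M).image (fun j => n + j + 1)).biUnion (sph r))
    (fun _ _ => by positivity))
  rw [Finset.sum_congr rfl (g := fun x => Vs s n ^ 2 * (s⁻¹ ^ x.norm) ^ 2), ← Finset.mul_sum,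
    sum_biUnion_sph hq, Finset.sum_image,
    Finset.sum_congr rfl (fun k _ => Cs_mul hs0 (n + k))]
  · simp
  · intro a _ b _ h; simpa using h
  · intro x hx
    simp only [Finset.mem_biUnion, Finset.mem_image, Finset.mem_range, mem_sph] at hx
    obtain ⟨_, ⟨j, hj, rfl⟩, hx⟩ := hx
    rw [tf_apply hs0 hq n _ x (by omega) (by omega), Complex.norm_real, Real.norm_eq_abs, sq_abs]
    ring

lemma memlp_iff {G : Type*} (f : G → ℂ) : Memℓp f 2 ↔ Summable fun x => ‖f x‖ ^ 2 := by
  rw [memℓp_gen_iff (by simp)]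
  simp

lemma tendsto_ratio (A : ℝ) (hA : 0 < A) (n : ℕ) :
    Filter.Tendsto (fun M : ℕ => (M * A) / (1 + ((2 * n + M : ℕ) : ℝ) * A)) Filter.atTop
      (nhds 1) := by
  have h : Filter.Tendsto (fun M : ℕ => 1 - (1 + 2 * n * A) / (1 + ((2 * n + M : ℕ) : ℝ) * A))
      Filter.atTop (nhds (1 - 0)) := by
    refine tendsto_const_nhds.sub (Filter.Tendsto.const_div_atTop ?_ _)
    refine Filter.tendsto_atTop_add_const_left _ _ (Filter.Tendsto.atTop_mul_const hA ?_)
    refine tendsto_natCast_atTop_atTop.comp ?_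
    exact Filter.tendsto_atTop_mono (fun M => Nat.le_add_left M (2 * n)) Filter.tendsto_id
  rw [sub_zero] at h
  refine h.congr fun M => ?_
  have : (1 + ((2 * n + M : ℕ) : ℝ) * A) ≠ 0 := by positivity
  push_cast at *
  field_simp
  ring

end SphNorm

/-- **Norm of the spherical averaging operator of the regular representation of a free
group.** Let `Γ` be the free group of rank `r ≥ 1`, `S = {a₁^{±1},…,a_r^{±1}}`,
`q = 2r−1`, and `S_n` the set of elements of word length exactly `n`. The operator
`A_n f (x) = (1/|S_n|) ∑_{γ∈S_n} f(xγ)` on `ℓ²(Γ)` has operator norm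
`(1 + ((q−1)/(q+1))·n)·q^{−n/2}`. -/
theorem regular_sphere_operator_norm (r : ℕ) (hr : 1 ≤ r) (n : ℕ)
    (Sn : Finset (FreeGroup (Fin r)))
    (hSn : (Sn : Set (FreeGroup (Fin r))) = wordSphere (freeGens r) n) :
    sSup { ρ : ℝ | ∃ f : FreeGroup (Fin r) → ℂ, Memℓp f 2 ∧ l2Norm f = 1 ∧
        ρ = l2Norm (fun x => (∑ γ ∈ Sn, f (x * γ)) / (Sn.card : ℂ)) } =
      (1 + ((2 * (r : ℝ) - 1) - 1) / ((2 * (r : ℝ) - 1) + 1) * n) *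
        (2 * (r : ℝ) - 1) ^ (-(n : ℝ) / 2) := by
  have hr' : (1 : ℝ) ≤ r := by exact_mod_cast hr
  obtain ⟨s, hs⟩ : ∃ s, s = Real.sqrt (2 * (r : ℝ) - 1) := ⟨_, rfl⟩
  have hq : s ^ 2 = 2 * (r : ℝ) - 1 := by rw [hs]; exact Real.sq_sqrt (by linarith)
  have hs1 : 1 ≤ s := by rw [hs]; exact Real.one_le_sqrt.2 (by linarith)
  have hs0 : 0 < s := by linarith
  have hSn' : Sn = SphNorm.sph r n := by
    ext x
    rw [SphNorm.mem_sph, ← SphNorm.mem_wordSphere, ← hSn, Finset.mem_coe]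
  subst hSn'
  have hpow : (2 * (r : ℝ) - 1) ^ (-(n : ℝ) / 2) = s⁻¹ ^ n := by
    rw [← hq, ← Real.rpow_natCast s 2, ← Real.rpow_mul hs0.le, inv_pow, ← Real.rpow_natCast s n,
      ← Real.rpow_neg hs0.le]
    congr 1; push_cast; ring
  rw [hpow, ← hq]
  have hC := SphNorm.Cs_pos hs0 n
  have hV := SphNorm.Vs_eq hs0 n
  have hcard := SphNorm.card_sph hq n
  set φ := (1 + (s ^ 2 - 1) / (s ^ 2 + 1) * (n : ℝ)) * s⁻¹ ^ n with hφ
  have hφ0 : 0 < φ := by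
    have h : 0 ≤ s ^ 2 - 1 := by nlinarith
    positivity
  -- evaluation of the norms
  have hnorm : ∀ f : FreeGroup (Fin r) → ℂ,
      l2Norm (fun x => (∑ γ ∈ SphNorm.sph r n, f (x * γ)) / ((SphNorm.sph r n).card : ℂ)) =
        (SphNorm.Cs s n)⁻¹ * Real.sqrt (∑' x, ‖∑ γ ∈ SphNorm.sph r n, f (x * γ)‖ ^ 2) := by
    intro f
    have : ∀ x, ‖(∑ γ ∈ SphNorm.sph r n, f (x * γ)) / ((SphNorm.sph r n).card : ℂ)‖ ^ 2 =
        ((SphNorm.Cs s n)⁻¹) ^ 2 * ‖∑ γ ∈ SphNorm.sph r n, f (x * γ)‖ ^ 2 := by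
      intro x
      rw [norm_div, Complex.norm_natCast, hcard]
      ring
    simp only [l2Norm, this]
    rw [tsum_mul_left, Real.sqrt_mul (by positivity), Real.sqrt_sq (by positivity)]
  have hmem : ∀ M : ℕ, ∃ ρ ∈ { ρ : ℝ | ∃ f : FreeGroup (Fin r) → ℂ, Memℓp f 2 ∧ l2Norm f = 1 ∧
        ρ = l2Norm (fun x => (∑ γ ∈ SphNorm.sph r n, f (x * γ)) / ((SphNorm.sph r n).card : ℂ)) },
      φ * Real.sqrt ((M * ((s ^ 2 + 1) / s ^ 2)) /
        (1 + ((2 * n + M : ℕ) : ℝ) * ((s ^ 2 + 1) / s ^ 2))) ≤ ρ := by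
    intro M
    have hT := SphNorm.tf_hasSum hs0 hq (r := r) (2 * n + M)
    have hlow := SphNorm.lower hs1 hq (r := r) n M
    set Q := 1 + ((2 * n + M : ℕ) : ℝ) * ((s ^ 2 + 1) / s ^ 2) with hQ
    have hQ0 : 0 < Q := by positivity
    set f := SphNorm.tf r s (2 * n + M) with hf
    have hsq : ∀ z : ℂ, ‖(((Real.sqrt Q)⁻¹ : ℝ) : ℂ) * z‖ ^ 2 = Q⁻¹ * ‖z‖ ^ 2 := by
      intro z
      rw [norm_mul, Complex.norm_real, mul_pow, Real.norm_eq_abs, sq_abs, inv_pow,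
        Real.sq_sqrt hQ0.le]
    refine ⟨_, ⟨fun x => (((Real.sqrt Q)⁻¹ : ℝ) : ℂ) * f x, ?_, ?_, rfl⟩, ?_⟩
    · rw [SphNorm.memlp_iff]
      simp only [hsq]
      exact hT.summable.mul_left _
    · simp only [l2Norm, hsq]
      rw [tsum_mul_left, hT.tsum_eq, inv_mul_cancel₀ hQ0.ne', Real.sqrt_one]
    · rw [hnorm (fun x => (((Real.sqrt Q)⁻¹ : ℝ) : ℂ) * f x)]
      simp only [← Finset.mul_sum, hsq]
      rw [tsum_mul_left, ← div_eq_inv_mul, le_div_iff₀ hC, mul_right_comm, mul_comm φ, ← hV]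
      apply Real.le_sqrt_of_sq_le
      rw [mul_pow, Real.sq_sqrt (by positivity), ← mul_div_assoc, div_eq_inv_mul]
      exact mul_le_mul_of_nonneg_left hlow (by positivity)
  apply csSup_eq_of_forall_le_of_forall_lt_exists_gt
  · obtain ⟨ρ, hρ, -⟩ := hmem 0
    exact ⟨ρ, hρ⟩
  · rintro ρ ⟨f, hf, hf1, rfl⟩
    rw [SphNorm.memlp_iff] at hf
    have h1 : ∑' x, ‖f x‖ ^ 2 = 1 := by
      rw [l2Norm, Real.sqrt_eq_one] at hf1; exact hf1
    have h2 := (SphNorm.upper hs1 hq n f hf).2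
    rw [h1, mul_one] at h2
    rw [hnorm, inv_mul_le_iff₀ hC, ← hV]
    refine Real.sqrt_le_iff.2 ⟨?_, h2⟩
    rw [hV]; positivity
  · intro w hw
    have ht := ((SphNorm.tendsto_ratio ((s ^ 2 + 1) / s ^ 2) (by positivity) n).sqrt).const_mul φ
    rw [Real.sqrt_one, mul_one] at ht
    obtain ⟨M, hM⟩ := (ht.eventually (lt_mem_nhds hw)).exists
    obtain ⟨ρ, hρ, hle⟩ := hmem M
    exact ⟨ρ, hρ, hM.trans_le hle⟩

end
end

section
/- Let Γ be a free group of rank r ≥ 1 with free generating set {a₁,…,a_r}, let S = {a₁^{±1},…,a_r^{±1}} and q = 2r−1. For n ∈ ℕ let B_n be the set of elements of Γ of word length at most n with respect to S, and let C_n be the bounded operator on ℓ²(Γ) defined by (C_n f)(x) = (1/|B_n|) Σ_{γ∈B_n} f(xγ). Then the operator norm of C_n equals c(q,n)·(1 + (1 + q^{−1/2})·n)·q^{−n/2}, where c(q,n) = (1 + 2q^{−n} Σ_{k=0}^{n−1} q^k)^{−1}. -/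
open MeasureTheory

noncomputable section

namespace BallNorm

open FreeGroup

lemma norm_cons_nil {r : ℕ} (δ : FreeGroup (Fin r)) (h : δ.toWord = []) (s : Fin r × Bool) :
    (FreeGroup.mk [s] * δ).norm = 1 := by
  simp [FreeGroup.norm, toWord_mul, h]

lemma norm_cons_cons {r : ℕ} (δ : FreeGroup (Fin r)) (hd : Fin r × Bool)
    (tl : List (Fin r × Bool)) (h : δ.toWord = hd :: tl) (s : Fin r × Bool) :
    (FreeGroup.mk [s] * δ).norm = if s = (hd.1, !hd.2) then δ.norm - 1 else δ.norm + 1 := by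
  have h1 : (FreeGroup.mk [s] * δ).toWord = reduce (s :: δ.toWord) := by
    rw [toWord_mul, toWord_mk, reduce_singleton]; rfl
  rw [FreeGroup.norm, h1, reduce.cons, reduce_toWord, FreeGroup.norm, h]
  have h2 : s = (hd.1, !hd.2) ↔ (s.1 = hd.1 ∧ s.2 = !hd.2) := Prod.ext_iff
  simp only [h2]
  split_ifs <;> simp

lemma sum_norm {r : ℕ} {R : Type*} [CommRing R] (δ : FreeGroup (Fin r)) (φ : ℕ → R) :
    ∑ s : Fin r × Bool, φ ((FreeGroup.mk [s] * δ).norm) =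
      if δ.norm = 0 then (2 * (r : R)) * φ 1
      else φ (δ.norm - 1) + (2 * (r : R) - 1) * φ (δ.norm + 1) := by
  rcases h : δ.toWord with _ | ⟨hd, tl⟩
  · have h0 : δ.norm = 0 := by simp [FreeGroup.norm, h]
    simp only [norm_cons_nil δ h, h0, if_true]
    simp [Finset.card_univ]
    ring
  · have h0 : δ.norm ≠ 0 := by simp [FreeGroup.norm, h]
    simp only [norm_cons_cons δ hd tl h, h0, if_false]
    have : ∀ s : Fin r × Bool, φ (if s = (hd.1, !hd.2) then δ.norm - 1 else δ.norm + 1) =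
      φ (δ.norm + 1) + if s = (hd.1, !hd.2) then φ (δ.norm - 1) - φ (δ.norm + 1) else 0 := by
      intro s; split_ifs <;> ring
    simp only [this, Finset.sum_add_distrib, Finset.sum_ite_eq', Finset.mem_univ, if_true]
    simp [Finset.card_univ]
    ring

lemma ball_finite (r n : ℕ) : {g : FreeGroup (Fin r) | g.norm ≤ n}.Finite := by
  apply Set.Finite.of_finite_image (f := toWord)
  · apply (List.finite_length_le (Fin r × Bool) n).subset
    rintro _ ⟨g, hg, rfl⟩
    exact hg
  · exact toWord_injective.injOn

def ball (r n : ℕ) : Finset (FreeGroup (Fin r)) := (ball_finite r n).toFinset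

lemma mem_ball {r n : ℕ} {g : FreeGroup (Fin r)} : g ∈ ball r n ↔ g.norm ≤ n := by
  simp [ball]

lemma gens_eq {r : ℕ} (g : FreeGroup (Fin r)) : g ∈ freeGens r ↔ ∃ s, g = FreeGroup.mk [s] := by
  constructor
  · rintro ⟨i, h | h⟩
    · exact ⟨(i, true), h⟩
    · exact ⟨(i, false), by rw [h]; rfl⟩
  · rintro ⟨⟨i, b⟩, h⟩
    refine ⟨i, ?_⟩
    cases b
    · right; rw [h]; rfl
    · left; rw [h]; rfl

lemma norm_le_of_wordProds {r : ℕ} : ∀ (n : ℕ) (g : FreeGroup (Fin r)),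
    g ∈ wordProds (freeGens r) n → g.norm ≤ n := by
  intro n
  induction n with
  | zero => rintro g ⟨w, _, rfl⟩; simp
  | succ n ih =>
    rintro g ⟨w, hw, rfl⟩
    rw [List.ofFn_succ, List.prod_cons]
    refine (FreeGroup.norm_mul_le _ _).trans ?_
    have h1 := ih _ ⟨fun i => w i.succ, fun i => hw _, rfl⟩
    obtain ⟨s, hs⟩ := (gens_eq _).1 (hw 0)
    have h2 : (w 0).norm ≤ 1 := by
      rw [hs]; exact norm_mk_le
    omega

lemma mem_wordProds {r : ℕ} (L : List (Fin r × Bool)) :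
    FreeGroup.mk L ∈ wordProds (freeGens r) L.length := by
  refine ⟨fun i => FreeGroup.mk [L.get i], fun i => (gens_eq _).2 ⟨_, rfl⟩, ?_⟩
  have : List.ofFn (fun i => FreeGroup.mk [L.get i]) = L.map (fun s => FreeGroup.mk [s]) := by
    apply List.ext_getElem <;> simp
  rw [this]
  clear this
  induction L with
  | nil => rfl
  | cons a L ih => rw [List.map_cons, List.prod_cons, ih, mul_mk]; rfl

lemma wordBall_eq (r n : ℕ) : wordBall (freeGens r) n = (ball r n : Set (FreeGroup (Fin r))) := by
  ext g
  simp only [wordBall, wordSphere, Set.mem_iUnion, Finset.mem_range, Set.mem_sdiff,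
    Finset.mem_coe, mem_ball]
  constructor
  · rintro ⟨k, hk, h, _⟩
    exact (norm_le_of_wordProds k g h).trans (by omega)
  · intro h
    refine ⟨g.norm, by omega, ?_, ?_⟩
    · have := mem_wordProds g.toWord
      rwa [mk_toWord] at this
    · rintro ⟨k, hk, h'⟩
      exact absurd (norm_le_of_wordProds k g h') (by omega)

variable {R : Type*} [CommRing R]

def opA (r : ℕ) (f : FreeGroup (Fin r) → R) (x : FreeGroup (Fin r)) : R :=
  ∑ s : Fin r × Bool, f (x * (FreeGroup.mk [s])⁻¹)

def opB (r n : ℕ) (f : FreeGroup (Fin r) → R) (x : FreeGroup (Fin r)) : R :=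
  ∑ γ ∈ ball r n, f (x * γ)

lemma opA_radial (r : ℕ) (φ : ℕ → R) (x : FreeGroup (Fin r)) :
    opA r (fun y => φ y.norm) x = if x.norm = 0 then (2 * (r : R)) * φ 1
      else φ (x.norm - 1) + (2 * (r : R) - 1) * φ (x.norm + 1) := by
  have := sum_norm x⁻¹ φ
  rw [norm_inv_eq] at this
  rw [← this, opA]
  refine Finset.sum_congr rfl fun s _ => ?_
  rw [← norm_inv_eq (x := x * _)]; simp

lemma opB_zero (r : ℕ) (f : FreeGroup (Fin r) → R) : opB r 0 f = f := by
  funext x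
  have : ball r 0 = {1} := by ext g; simp [mem_ball]
  simp [opB, this]

lemma opA_opB_aux (r n : ℕ) (f : FreeGroup (Fin r) → R) (x : FreeGroup (Fin r)) :
    opA r (opB r n f) x = ∑ δ ∈ ball r (n + 1), f (x * δ) *
      ∑ s : Fin r × Bool, (if (FreeGroup.mk [s] * δ).norm ≤ n then (1 : R) else 0) := by
  simp only [opA, opB, Finset.mul_sum]
  rw [Finset.sum_comm (s := ball r (n + 1))]
  refine Finset.sum_congr rfl fun s _ => ?_
  simp only [mul_ite, mul_one, mul_zero]
  rw [← Finset.sum_filter]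
  refine Finset.sum_bij (fun γ _ => (FreeGroup.mk [s])⁻¹ * γ) ?_ ?_ ?_ ?_
  · intro γ hγ
    rw [mem_ball] at hγ
    simp only [Finset.mem_filter, mem_ball, mul_inv_cancel_left]
    refine ⟨(FreeGroup.norm_mul_le _ _).trans ?_, hγ⟩
    have : (FreeGroup.mk [s]).norm ≤ 1 := norm_mk_le
    rw [norm_inv_eq]; omega
  · intro a _ b _ h; exact mul_left_cancel h
  · intro δ hδ
    refine ⟨FreeGroup.mk [s] * δ, mem_ball.2 (Finset.mem_filter.1 hδ).2, inv_mul_cancel_left _ _⟩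
  · intro γ _; rw [mul_assoc]

lemma opA_opB (r n : ℕ) (f : FreeGroup (Fin r) → R) (x : FreeGroup (Fin r)) :
    opA r (opB r (n + 1) f) x =
      opB r (n + 2) f x + (2 * (r : R) - 1) * opB r n f x := by
  rw [opA_opB_aux]
  have h1 : ∀ δ ∈ ball r (n + 2), f (x * δ) *
      ∑ s : Fin r × Bool, (if (FreeGroup.mk [s] * δ).norm ≤ n + 1 then (1 : R) else 0) =
      f (x * δ) + if δ.norm ≤ n then (2 * (r : R) - 1) * f (x * δ) else 0 := by
    intro δ hδ
    rw [mem_ball] at hδ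
    rw [sum_norm δ (fun m => if m ≤ n + 1 then (1 : R) else 0)]
    by_cases h0 : δ.norm = 0
    · simp [h0]; ring
    · by_cases h : δ.norm ≤ n
      · simp only [h0, h, if_false, if_true]
        rw [if_pos (by omega), if_pos (by omega)]; ring
      · simp only [h0, h, if_false]
        rw [if_pos (by omega), if_neg (by omega)]; ring
  rw [Finset.sum_congr rfl h1, Finset.sum_add_distrib, ← Finset.sum_filter, ← Finset.mul_sum]
  have : (ball r (n + 2)).filter (fun δ => δ.norm ≤ n) = ball r n := by
    ext g; simp only [Finset.mem_filter, mem_ball]; omega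
  rw [this]; rfl

lemma opA_eq (r : ℕ) (f : FreeGroup (Fin r) → R) (x : FreeGroup (Fin r)) :
    opA r f x = opB r 1 f x - f x := by
  have h := opA_opB_aux r 0 f x
  rw [opB_zero] at h
  rw [h]
  have h1 : ∀ δ ∈ ball r (0 + 1), f (x * δ) *
      ∑ s : Fin r × Bool, (if (FreeGroup.mk [s] * δ).norm ≤ 0 then (1 : R) else 0) =
      f (x * δ) - if δ = 1 then f (x * δ) else 0 := by
    intro δ hδ
    rw [mem_ball] at hδ
    rw [sum_norm δ (fun m => if m ≤ 0 then (1 : R) else 0)]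
    by_cases h0 : δ.norm = 0
    · have := norm_eq_zero.1 h0
      simp [this]
    · have h2 : δ ≠ 1 := fun h => h0 (by simp [h])
      have h3 : δ.norm = 1 := by omega
      simp [h3, h2]
  rw [Finset.sum_congr rfl h1, Finset.sum_sub_distrib, Finset.sum_ite_eq']
  simp [opB, mem_ball]

lemma card_ball (r : ℕ) : ∀ n : ℕ, ((ball r n).card : R) = (2 * (r : R) - 1) ^ n +
    2 * ∑ k ∈ Finset.range n, (2 * (r : R) - 1) ^ k := by
  have hB : ∀ n, opB r n (fun _ => (1 : R)) 1 = ((ball r n).card : R) := by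
    intro n; simp [opB]
  have hB' : ∀ n, opB r n (fun _ => (1 : R)) = fun _ => ((ball r n).card : R) := by
    intro n; funext x; simp [opB]
  have hA : ∀ c : R, opA r (fun _ => c) 1 = 2 * (r : R) * c := by
    intro c; simp [opA, Finset.card_univ]; ring
  have h0 : ((ball r 0).card : R) = 1 := by rw [← hB, opB_zero]
  have h1 : ((ball r 1).card : R) = 2 * r + 1 := by
    have := opA_eq r (fun _ => (1 : R)) 1
    rw [hA, hB] at this; linear_combination -this
  intro n
  induction n using Nat.twoStepInduction with
  | zero => simp [h0]
  | one => simp [h1]; ring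
  | more n ih1 ih2 =>
    have := opA_opB r n (fun _ => (1 : R)) 1
    rw [hB, hB, hB', hA] at this
    have e : ((ball r (n + 2)).card : R) = 2 * (r : R) * ((ball r (n + 1)).card : R) -
      (2 * (r : R) - 1) * ((ball r n).card : R) := by linear_combination -this
    rw [e, ih1, ih2]
    simp only [Finset.sum_range_succ]
    ring

lemma ball_sum_succ (r n : ℕ) (φ : ℕ → ℝ) :
    ∑ γ ∈ ball r (n + 1), φ γ.norm = ∑ γ ∈ ball r n, φ γ.norm +
      (2 * (r : ℝ)) * (2 * (r : ℝ) - 1) ^ n * φ (n + 1) := by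
  have hsub : ball r n ⊆ ball r (n + 1) := by
    intro g; simp only [mem_ball]; omega
  rw [← Finset.sum_sdiff hsub, add_comm]
  congr 1
  have h : ∀ γ ∈ ball r (n + 1) \ ball r n, φ γ.norm = φ (n + 1) := by
    intro γ hγ
    simp only [Finset.mem_sdiff, mem_ball] at hγ
    congr 1; omega
  rw [Finset.sum_congr rfl h, Finset.sum_const, nsmul_eq_mul,
    Finset.cast_card_sdiff hsub, card_ball, card_ball, Finset.sum_range_succ]
  ring

lemma ball_sum_zero (r : ℕ) (φ : ℕ → ℝ) : ∑ γ ∈ ball r 0, φ γ.norm = φ 0 := by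
  have : ball r 0 = {1} := by ext g; simp [mem_ball]
  simp [this]

lemma memL2_iff {ι : Type*} (f : ι → ℂ) : Memℓp f 2 ↔ Summable fun i => ‖f i‖ ^ 2 := by
  rw [memℓp_gen_iff (by norm_num)]
  simp

lemma l2Norm_eq {ι : Type*} (f : ι → ℂ) (hf : Memℓp f 2) :
    l2Norm f = ‖(⟨f, hf⟩ : lp (fun _ : ι => ℂ) 2)‖ := by
  rw [lp.norm_eq_tsum_rpow (by norm_num)]
  simp [l2Norm, Real.sqrt_eq_rpow]

lemma l2Norm_nonneg {ι : Type*} (f : ι → ℂ) : 0 ≤ l2Norm f := Real.sqrt_nonneg _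

lemma l2Norm_add_le {ι : Type*} {f g : ι → ℂ} (hf : Memℓp f 2) (hg : Memℓp g 2) :
    l2Norm (f + g) ≤ l2Norm f + l2Norm g := by
  rw [l2Norm_eq _ hf, l2Norm_eq _ hg, l2Norm_eq _ (hf.add hg)]
  exact norm_add_le (⟨f, hf⟩ : lp (fun _ : ι => ℂ) 2) ⟨g, hg⟩

lemma l2Norm_smul {ι : Type*} (c : ℂ) (f : ι → ℂ) :
    l2Norm (fun x => c * f x) = ‖c‖ * l2Norm f := by
  simp only [l2Norm, norm_mul, mul_pow, tsum_mul_left]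
  rw [Real.sqrt_mul (by positivity), Real.sqrt_sq (norm_nonneg _)]

lemma memL2_smul {ι : Type*} (c : ℂ) {f : ι → ℂ} (hf : Memℓp f 2) :
    Memℓp (fun x => c * f x) 2 := hf.const_smul c

lemma memL2_shift {G : Type*} [Group G] {f : G → ℂ} (hf : Memℓp f 2) (g : G) :
    Memℓp (fun x => f (x * g)) 2 := by
  rw [memL2_iff] at *
  exact (Equiv.mulRight g).summable_iff.2 hf

lemma l2Norm_shift {G : Type*} [Group G] (f : G → ℂ) (g : G) :
    l2Norm (fun x => f (x * g)) = l2Norm f := by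
  unfold l2Norm
  congr 1
  exact (Equiv.mulRight g).tsum_eq (fun x => ‖f x‖ ^ 2)

lemma l2_sum {ι κ : Type*} (s : Finset κ) (F : κ → ι → ℂ) (hF : ∀ k, Memℓp (F k) 2) :
    Memℓp (fun x => ∑ k ∈ s, F k x) 2 ∧
      l2Norm (fun x => ∑ k ∈ s, F k x) ≤ ∑ k ∈ s, l2Norm (F k) := by
  classical
  induction s using Finset.induction_on with
  | empty =>
    refine ⟨?_, ?_⟩
    · simp only [Finset.sum_empty]; exact (zero_memℓp : Memℓp (0 : ι → ℂ) 2)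
    · simp [l2Norm]
  | insert a s ha ih =>
    simp only [Finset.sum_insert ha]
    exact ⟨(hF a).add ih.1, (l2Norm_add_le (hF a) ih.1).trans (by linarith [ih.2])⟩

lemma opA_l2 (r : ℕ) {f : FreeGroup (Fin r) → ℂ} (hf : Memℓp f 2) :
    Memℓp (opA r f) 2 ∧ l2Norm (opA r f) ≤ 2 * r * l2Norm f := by
  have := l2_sum (Finset.univ : Finset (Fin r × Bool))
    (fun s x => f (x * (FreeGroup.mk [s])⁻¹)) (fun s => memL2_shift hf _)
  refine ⟨this.1, this.2.trans (le_of_eq ?_)⟩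
  simp only [l2Norm_shift f]
  rw [Finset.sum_const, nsmul_eq_mul]
  congr 1
  simp [Finset.card_univ]; ring

lemma opB_mem (r n : ℕ) {f : FreeGroup (Fin r) → ℂ} (hf : Memℓp f 2) :
    Memℓp (opB r n f) 2 :=
  (l2_sum (ball r n) (fun γ x => f (x * γ)) (fun _ => memL2_shift hf _)).1

/-- Schur test with a positive eigenfunction. -/
lemma schur (r n : ℕ) (h : FreeGroup (Fin r) → ℝ) (hpos : ∀ x, 0 < h x) (b : ℝ) (hb : 0 ≤ b)
    (heig : ∀ x, opB r n h x = b * h x) {f : FreeGroup (Fin r) → ℂ} (hf : Memℓp f 2) :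
    l2Norm (opB r n f) ≤ b * l2Norm f := by
  have hfs := (memL2_iff f).1 hf
  set F : FreeGroup (Fin r) → ℝ := fun x => ‖f x‖ ^ 2 with hF
  have hF0 : ∀ x, 0 ≤ F x := fun x => by positivity
  let K : FreeGroup (Fin r) → FreeGroup (Fin r) → ℝ := fun γ y => h (y * γ⁻¹) / h y * F y
  have hKsum : ∀ y, ∑ γ ∈ ball r n, K γ y = b * F y := by
    intro y
    have : ∑ γ ∈ ball r n, h (y * γ⁻¹) = b * h y := by
      rw [← heig]
      refine Finset.sum_bij (fun γ _ => γ⁻¹) ?_ ?_ ?_ ?_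
      · intro γ hγ; simpa [mem_ball] using hγ
      · intro a _ c _ hac; exact inv_injective hac
      · intro γ hγ; exact ⟨γ⁻¹, by simpa [mem_ball] using hγ, inv_inv _⟩
      · intro γ _; rfl
    simp only [K]
    rw [← Finset.sum_mul, ← Finset.sum_div, this, mul_div_cancel_right₀ _ (hpos y).ne']
  have hK0 : ∀ γ y, 0 ≤ K γ y := fun γ y =>
    mul_nonneg (div_nonneg (hpos _).le (hpos _).le) (hF0 _)
  have hKs : ∀ γ ∈ ball r n, Summable (K γ) := by
    intro γ hγ
    refine Summable.of_nonneg_of_le (hK0 γ) (fun y => ?_) (hfs.mul_left b)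
    rw [← hKsum]
    exact Finset.single_le_sum (f := fun γ => K γ y) (fun g _ => hK0 g y) hγ
  have hKs' : ∀ γ ∈ ball r n, Summable (fun x => K γ (x * γ)) := fun γ hγ =>
    (Equiv.mulRight γ).summable_iff.2 (hKs γ hγ)
  have hpt : ∀ x, ‖opB r n f x‖ ^ 2 ≤ b * ∑ γ ∈ ball r n, K γ (x * γ) := by
    intro x
    have h1 : ‖opB r n f x‖ ≤ ∑ γ ∈ ball r n, ‖f (x * γ)‖ := norm_sum_le _ _
    have h2 : (∑ γ ∈ ball r n, ‖f (x * γ)‖) ^ 2 ≤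
        (∑ γ ∈ ball r n, h (x * γ)) * ∑ γ ∈ ball r n, F (x * γ) / h (x * γ) := by
      apply Finset.sum_sq_le_sum_mul_sum_of_sq_le_mul
      · intro γ _; exact (hpos _).le
      · intro γ _; exact div_nonneg (hF0 _) (hpos _).le
      · intro γ _; exact (mul_div_cancel₀ _ (hpos _).ne').ge
    calc ‖opB r n f x‖ ^ 2 ≤ (∑ γ ∈ ball r n, ‖f (x * γ)‖) ^ 2 := by gcongr
      _ ≤ _ := h2
      _ = (b * h x) * ∑ γ ∈ ball r n, F (x * γ) / h (x * γ) := by rw [← heig]; rfl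
      _ = _ := by
        rw [mul_assoc, Finset.mul_sum]
        congr 1
        refine Finset.sum_congr rfl fun γ _ => ?_
        simp only [K, mul_inv_cancel_right]; ring
  have hS : Summable fun x => b * ∑ γ ∈ ball r n, K γ (x * γ) :=
    (summable_sum hKs').mul_left b
  have htot : ∑' x, ‖opB r n f x‖ ^ 2 ≤ b ^ 2 * ∑' x, F x := by
    calc ∑' x, ‖opB r n f x‖ ^ 2 ≤ ∑' x, b * ∑ γ ∈ ball r n, K γ (x * γ) :=
          Summable.tsum_le_tsum hpt ((memL2_iff _).1 (opB_mem r n hf)) hS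
      _ = b * ∑ γ ∈ ball r n, ∑' x, K γ (x * γ) := by
          rw [tsum_mul_left, Summable.tsum_finsetSum hKs']
      _ = b * ∑ γ ∈ ball r n, ∑' x, K γ x := by
          congr 1
          exact Finset.sum_congr rfl fun γ _ => (Equiv.mulRight γ).tsum_eq (K γ)
      _ = b ^ 2 * ∑' x, F x := by
          rw [← Summable.tsum_finsetSum hKs]
          simp only [hKsum]
          rw [tsum_mul_left]; ring
  unfold l2Norm
  rw [← Real.sqrt_sq hb, ← Real.sqrt_mul (by positivity)]
  exact Real.sqrt_le_sqrt htot

def beta (s : ℝ) (n : ℕ) : ℝ := s ^ n * (n + 1) + s ^ n * n * s⁻¹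

lemma beta_nonneg {s : ℝ} (hs : 0 < s) (n : ℕ) : 0 ≤ beta s n := by
  unfold beta; positivity

lemma beta_rec {s : ℝ} (hs : 0 < s) (n : ℕ) :
    beta s (n + 2) = 2 * s * beta s (n + 1) - s ^ 2 * beta s n := by
  unfold beta; push_cast; field_simp; ring

lemma eigen_step (r : ℕ) (s : ℝ) (hs : 0 < s) (hsq : s ^ 2 = 2 * r - 1)
    (h : FreeGroup (Fin r) → ℝ) (hA : ∀ x, opA r h x = 2 * s * h x) :
    ∀ n x, opB r n h x = beta s n * h x := by
  intro n
  induction n using Nat.twoStepInduction with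
  | zero => intro x; simp [opB_zero, beta]
  | one =>
    intro x
    have := opA_eq r h x
    rw [hA] at this
    have hb : beta s 1 = 2 * s + 1 := by unfold beta; field_simp; norm_num
    rw [hb]; linarith
  | more n ih1 ih2 =>
    intro x
    have := opA_opB r n h x
    have h2 : opB r (n + 1) h = fun x => beta s (n + 1) * h x := funext ih2
    have h3 : opA r (fun x => beta s (n + 1) * h x) x = beta s (n + 1) * opA r h x := by
      simp [opA, Finset.mul_sum]
    rw [h2, h3, hA, ih1] at this
    rw [beta_rec hs]
    rw [hsq]
    linear_combination -this

def sph (s : ℝ) (m : ℕ) : ℝ := (1 + m * ((s ^ 2 - 1) / (s ^ 2 + 1))) * s⁻¹ ^ m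

lemma sph_eig (r : ℕ) (s : ℝ) (hs : 1 ≤ s) (hsq : s ^ 2 = 2 * r - 1) (x : FreeGroup (Fin r)) :
    opA r (fun y => sph s y.norm) x = 2 * s * sph s x.norm := by
  rw [opA_radial, ← hsq]
  have h2r : 2 * (r : ℝ) = s ^ 2 + 1 := by linarith
  have hs0 : 0 < s := by linarith
  rw [h2r]
  rcases x.norm with _ | m
  · simp [sph]; field_simp; ring
  · simp only [Nat.add_one_ne_zero, if_false, Nat.add_sub_cancel, sph, inv_pow]
    push_cast
    field_simp
    ring

lemma upper (r : ℕ) (s : ℝ) (hs : 1 ≤ s) (hsq : s ^ 2 = 2 * r - 1) (n : ℕ)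
    {f : FreeGroup (Fin r) → ℂ} (hf : Memℓp f 2) :
    l2Norm (opB r n f) ≤ beta s n * l2Norm f := by
  have hs0 : 0 < s := by linarith
  refine schur r n (fun y => sph s y.norm) (fun x => ?_) _ (beta_nonneg hs0 n)
    (eigen_step r s hs0 hsq _ (sph_eig r s hs hsq) n) hf
  have : 0 ≤ s ^ 2 - 1 := by nlinarith
  unfold sph
  positivity

/-- error propagation for approximate eigenvectors -/
lemma err (r : ℕ) (s : ℝ) (hs : 0 < s) (hsq : s ^ 2 = 2 * r - 1) : ∀ n : ℕ, ∃ C : ℝ, 0 ≤ C ∧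
    ∀ f : FreeGroup (Fin r) → ℂ, Memℓp f 2 →
      l2Norm (fun x => opB r n f x - (beta s n : ℂ) * f x) ≤
        C * l2Norm (fun x => opA r f x - (2 * s : ℂ) * f x) := by
  intro n
  induction n using Nat.twoStepInduction with
  | zero =>
    refine ⟨0, le_rfl, fun f hf => ?_⟩
    simp [opB_zero, beta, l2Norm]
  | one =>
    refine ⟨1, zero_le_one, fun f hf => ?_⟩
    rw [one_mul]
    have hb : beta s 1 = 2 * s + 1 := by unfold beta; field_simp; norm_num
    have : (fun x => opB r 1 f x - (beta s 1 : ℂ) * f x) =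
        (fun x => opA r f x - (2 * s : ℂ) * f x) := by
      funext x; rw [opA_eq, hb]; push_cast; ring
    rw [this]
  | more n ih1 ih2 =>
    obtain ⟨C1, hC1, h1⟩ := ih1
    obtain ⟨C2, hC2, h2⟩ := ih2
    refine ⟨2 * r * C2 + beta s (n + 1) + s ^ 2 * C1, ?_, fun f hf => ?_⟩
    · have := beta_nonneg hs (n + 1); positivity
    have hE : ∀ m, Memℓp (fun x => opB r m f x - (beta s m : ℂ) * f x) 2 := fun m =>
      (opB_mem r m hf).sub (memL2_smul _ hf)
    have hD : Memℓp (fun x => opA r f x - (2 * s : ℂ) * f x) 2 :=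
      (opA_l2 r hf).1.sub (memL2_smul _ hf)
    have key : (fun x => opB r (n + 2) f x - (beta s (n + 2) : ℂ) * f x) =
        (opA r (fun x => opB r (n + 1) f x - (beta s (n + 1) : ℂ) * f x) +
          (fun x => (beta s (n + 1) : ℂ) * (opA r f x - (2 * s : ℂ) * f x))) +
          (fun x => (-(s : ℂ) ^ 2) * (opB r n f x - (beta s n : ℂ) * f x)) := by
      funext x
      have hrec := opA_opB r n f x
      have hl : opA r (fun x => opB r (n + 1) f x - (beta s (n + 1) : ℂ) * f x) x =
          opA r (opB r (n + 1) f) x - (beta s (n + 1) : ℂ) * opA r f x := by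
        simp [opA, Finset.mul_sum, Finset.sum_sub_distrib]
      have hsqC : (s : ℂ) ^ 2 = 2 * r - 1 := by exact_mod_cast congrArg (fun z : ℝ => (z : ℂ)) hsq
      have hbC : (beta s (n + 2) : ℂ) = 2 * s * beta s (n + 1) - s ^ 2 * beta s n := by
        exact_mod_cast congrArg (fun z : ℝ => (z : ℂ)) (beta_rec hs n)
      simp only [Pi.add_apply, hl, hrec, hbC, ← hsqC]
      ring
    rw [key]
    have m1 := (opA_l2 r (hE (n + 1)))
    refine (l2Norm_add_le (m1.1.add (memL2_smul _ hD)) (memL2_smul _ (hE n))).trans ?_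
    have a1 := l2Norm_add_le m1.1 (memL2_smul (beta s (n + 1) : ℂ) hD)
    rw [l2Norm_smul] at a1
    rw [l2Norm_smul]
    have n1 : ‖(beta s (n + 1) : ℂ)‖ = beta s (n + 1) := by
      rw [Complex.norm_real, Real.norm_of_nonneg (beta_nonneg hs _)]
    have n2 : ‖-(s : ℂ) ^ 2‖ = s ^ 2 := by
      rw [norm_neg, norm_pow, Complex.norm_real, Real.norm_of_nonneg hs.le]
    rw [n1] at a1
    rw [n2]
    have a2 := mul_le_mul_of_nonneg_left (h2 f hf) (by positivity : (0 : ℝ) ≤ 2 * r)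
    have a3 := mul_le_mul_of_nonneg_left (h1 f hf) (by positivity : (0 : ℝ) ≤ s ^ 2)
    have a4 := m1.2
    nlinarith [a1, a2, a3, a4]

def tst (s : ℝ) (N m : ℕ) : ℝ := if m ≤ N then s⁻¹ ^ m else 0

lemma radial_l2 (r M : ℕ) (φ : ℕ → ℝ) (hφ : ∀ m, M < m → φ m = 0) :
    Memℓp (fun x : FreeGroup (Fin r) => (φ x.norm : ℂ)) 2 ∧
    l2Norm (fun x : FreeGroup (Fin r) => (φ x.norm : ℂ)) =
      Real.sqrt (∑ γ ∈ ball r M, φ γ.norm ^ 2) := by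
  have h0 : ∀ x ∉ ball r M, ‖(φ x.norm : ℂ)‖ ^ 2 = 0 := by
    intro x hx
    rw [mem_ball, not_le] at hx
    simp [hφ _ hx]
  refine ⟨(memL2_iff _).2 (summable_of_ne_finset_zero h0), ?_⟩
  unfold l2Norm
  rw [tsum_eq_sum h0]
  simp

lemma tst_norm (r : ℕ) (s : ℝ) (hs : 1 ≤ s) (hsq : s ^ 2 = 2 * r - 1) (N M : ℕ) (h : M ≤ N) :
    (M : ℝ) ≤ ∑ γ ∈ ball r M, tst s N γ.norm ^ 2 := by
  have hs0 : 0 < s := by linarith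
  induction M with
  | zero => simp; positivity
  | succ M ih =>
    rw [ball_sum_succ r M (fun m => tst s N m ^ 2), ← hsq]
    have := ih (by omega)
    have h2r : 2 * (r : ℝ) = s ^ 2 + 1 := by linarith
    have e : 1 ≤ 2 * (r : ℝ) * (s ^ 2) ^ M * tst s N (M + 1) ^ 2 := by
      rw [h2r, tst, if_pos h]
      have : (s ^ 2 + 1) * (s ^ 2) ^ M * (s⁻¹ ^ (M + 1)) ^ 2 = 1 + (s ^ 2)⁻¹ := by
        simp only [inv_pow]
        field_simp
        ring
      rw [this]
      have : 0 ≤ (s ^ 2)⁻¹ := by positivity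
      linarith
    push_cast
    linarith

def errf (r : ℕ) (s : ℝ) (N m : ℕ) : ℝ :=
  (if m = 0 then (2 * (r : ℝ)) * tst s N 1
      else tst s N (m - 1) + (2 * (r : ℝ) - 1) * tst s N (m + 1)) - 2 * s * tst s N m

lemma errf_mid (r : ℕ) (s : ℝ) (hs : 0 < s) (hsq : s ^ 2 = 2 * r - 1) (N m : ℕ) (h : m < N) :
    errf r s (N + 1) (m + 1) = 0 := by
  simp only [errf, tst, Nat.add_one_ne_zero, if_false]
  rw [if_pos (by omega), if_pos (by omega), if_pos (by omega), ← hsq]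
  simp only [inv_pow, Nat.add_sub_cancel]
  field_simp; ring

lemma err_sum (r : ℕ) (s : ℝ) (hs : 1 ≤ s) (hsq : s ^ 2 = 2 * r - 1) (N : ℕ) :
    ∑ γ ∈ ball r (N + 2), errf r s (N + 1) γ.norm ^ 2 =
      ((s ^ 2 + 1) * s⁻¹ - 2 * s) ^ 2 + 2 * (s ^ 2 + 1) := by
  have hs0 : 0 < s := by linarith
  have h2r : 2 * (r : ℝ) = s ^ 2 + 1 := by linarith
  have hmid : ∀ M ≤ N, ∑ γ ∈ ball r M, errf r s (N + 1) γ.norm ^ 2 =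
      ((s ^ 2 + 1) * s⁻¹ - 2 * s) ^ 2 := by
    intro M hM
    induction M with
    | zero =>
      rw [ball_sum_zero r (fun m => errf r s (N + 1) m ^ 2)]
      simp [errf, tst, h2r]
    | succ M ih =>
      rw [ball_sum_succ r M (fun m => errf r s (N + 1) m ^ 2), ih (by omega),
        errf_mid r s hs0 hsq N M (by omega)]
      simp
  rw [ball_sum_succ r (N + 1) (fun m => errf r s (N + 1) m ^ 2),
    ball_sum_succ r N (fun m => errf r s (N + 1) m ^ 2), hmid N le_rfl]
  have e1 : errf r s (N + 1) (N + 1) = - (s⁻¹ ^ N) := by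
    simp only [errf, tst, Nat.add_one_ne_zero, if_false]
    rw [if_pos (by omega), if_neg (by omega), if_pos (by omega)]
    simp only [inv_pow, Nat.add_sub_cancel]
    field_simp; ring
  have e2 : errf r s (N + 1) (N + 1 + 1) = s⁻¹ ^ (N + 1) := by
    simp only [errf, tst, Nat.add_one_ne_zero, if_false]
    rw [if_pos (by omega), if_neg (by omega), if_neg (by omega)]
    simp
  rw [e1, e2, ← hsq, h2r]
  simp only [inv_pow, neg_sq]
  field_simp
  ring

lemma lower (r : ℕ) (s : ℝ) (hs : 1 ≤ s) (hsq : s ^ 2 = 2 * r - 1) (n : ℕ) (w : ℝ)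
    (hw : w < beta s n) :
    ∃ f : FreeGroup (Fin r) → ℂ, Memℓp f 2 ∧ l2Norm f = 1 ∧ w < l2Norm (opB r n f) := by
  have hs0 : 0 < s := by linarith
  obtain ⟨C, hC, hE⟩ := err r s hs0 hsq n
  set D := Real.sqrt (((s ^ 2 + 1) * s⁻¹ - 2 * s) ^ 2 + 2 * (s ^ 2 + 1)) with hD
  obtain ⟨N, hN⟩ := exists_nat_gt ((C * D / (beta s n - w)) ^ 2)
  let f : FreeGroup (Fin r) → ℂ := fun x => (tst s (N + 1) x.norm : ℂ)
  obtain ⟨hfm, hfn⟩ := radial_l2 r (N + 1) (tst s (N + 1)) (fun m hm => by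
    simp [tst, not_le.2 hm])
  have hAf : (fun x => opA r f x - (2 * s : ℂ) * f x) =
      fun x => (errf r s (N + 1) x.norm : ℂ) := by
    funext x
    rw [opA_radial r (fun m => (tst s (N + 1) m : ℂ)) x]
    simp only [f, errf]
    split_ifs <;> push_cast <;> ring
  have herr : l2Norm (fun x => opA r f x - (2 * s : ℂ) * f x) = D := by
    rw [hAf, (radial_l2 r (N + 2) (errf r s (N + 1)) (fun m hm => by
      simp only [errf, tst]
      rw [if_neg (by omega), if_neg (by omega), if_neg (by omega), if_neg (by omega)]
      ring)).2, err_sum r s hs hsq N]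
  have hbig : C * D / (beta s n - w) < l2Norm f := by
    change _ < l2Norm (fun x : FreeGroup (Fin r) => (tst s (N + 1) x.norm : ℂ))
    rw [hfn]
    apply Real.lt_sqrt_of_sq_lt
    have := tst_norm r s hs hsq (N + 1) (N + 1) le_rfl
    push_cast at this
    linarith
  have hD0 : 0 ≤ D := Real.sqrt_nonneg _
  have hbw : 0 < beta s n - w := by linarith
  have hpos : 0 < l2Norm f := lt_of_le_of_lt (by positivity) hbig
  have h1 := hE f hfm
  rw [herr] at h1
  rw [div_lt_iff₀ hbw] at hbig
  have h2 : beta s n * l2Norm f ≤ l2Norm (opB r n f) + C * D := by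
    have hB := opB_mem r n (f := f) hfm
    have hEm : Memℓp (fun x => opB r n f x - (beta s n : ℂ) * f x) 2 :=
      hB.sub (memL2_smul _ hfm)
    have : (fun x => (beta s n : ℂ) * f x) = opB r n f +
        fun x => (-1 : ℂ) * (opB r n f x - (beta s n : ℂ) * f x) := by
      funext x; simp
    have h3 := l2Norm_add_le hB (memL2_smul (-1) hEm)
    rw [← this, l2Norm_smul, l2Norm_smul, Complex.norm_real,
      Real.norm_of_nonneg (beta_nonneg hs0 n)] at h3
    simp only [norm_neg, NormOneClass.norm_one, one_mul] at h3
    linarith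
  have hc : ‖((l2Norm f)⁻¹ : ℂ)‖ = (l2Norm f)⁻¹ := by
    rw [norm_inv, Complex.norm_real, Real.norm_of_nonneg hpos.le]
  refine ⟨fun x => ((l2Norm f)⁻¹ : ℂ) * f x, memL2_smul _ hfm, ?_, ?_⟩
  · rw [l2Norm_smul, hc, inv_mul_cancel₀ hpos.ne']
  · have : opB r n (fun x => ((l2Norm f)⁻¹ : ℂ) * f x) =
        fun x => ((l2Norm f)⁻¹ : ℂ) * opB r n f x := by
      funext x; simp [opB, Finset.mul_sum]
    rw [this, l2Norm_smul, hc, inv_mul_eq_div, lt_div_iff₀ hpos]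
    nlinarith

end BallNorm

/-- **Norm of the ball averaging operator of the regular representation of a free
group.** Let `Γ` be the free group of rank `r ≥ 1`, `S = {a₁^{±1},…,a_r^{±1}}`,
`q = 2r−1`, and `B_n` the set of elements of word length at most `n`. The operator
`C_n f (x) = (1/|B_n|) ∑_{γ∈B_n} f(xγ)` on `ℓ²(Γ)` has operator norm
`c(q,n)·(1 + (1 + q^{−1/2})·n)·q^{−n/2}` where
`c(q,n) = (1 + 2q^{−n} ∑_{k=0}^{n−1} q^k)⁻¹`. -/
theorem regular_ball_operator_norm (r : ℕ) (hr : 1 ≤ r) (n : ℕ)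
    (Bn : Finset (FreeGroup (Fin r)))
    (hBn : (Bn : Set (FreeGroup (Fin r))) = wordBall (freeGens r) n) :
    sSup { ρ : ℝ | ∃ f : FreeGroup (Fin r) → ℂ, Memℓp f 2 ∧ l2Norm f = 1 ∧
        ρ = l2Norm (fun x => (∑ γ ∈ Bn, f (x * γ)) / (Bn.card : ℂ)) } =
      (1 + 2 * (2 * (r : ℝ) - 1) ^ (-(n : ℝ)) *
          ∑ k ∈ Finset.range n, (2 * (r : ℝ) - 1) ^ k)⁻¹ *
        ((1 + (1 + (2 * (r : ℝ) - 1) ^ (-(1 : ℝ) / 2)) * n) *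
          (2 * (r : ℝ) - 1) ^ (-(n : ℝ) / 2)) := by
  obtain rfl : Bn = BallNorm.ball r n := by
    apply Finset.coe_injective
    rw [hBn, BallNorm.wordBall_eq]
  have hr' : (1 : ℝ) ≤ r := by exact_mod_cast hr
  obtain ⟨s, hs, hsq⟩ : ∃ s : ℝ, 1 ≤ s ∧ s ^ 2 = 2 * (r : ℝ) - 1 :=
    ⟨Real.sqrt (2 * r - 1), by rw [Real.one_le_sqrt]; linarith, Real.sq_sqrt (by linarith)⟩
  have hs0 : 0 < s := by linarith
  have hcard := BallNorm.card_ball (R := ℝ) r n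
  rw [← hsq] at hcard ⊢
  have hcpos : 0 < ((BallNorm.ball r n).card : ℝ) := by
    rw [hcard]; positivity
  have hrhs : (1 + 2 * (s ^ 2) ^ (-(n : ℝ)) * ∑ k ∈ Finset.range n, (s ^ 2) ^ k)⁻¹ *
        ((1 + (1 + (s ^ 2) ^ (-(1 : ℝ) / 2)) * n) * (s ^ 2) ^ (-(n : ℝ) / 2)) =
      BallNorm.beta s n / ((BallNorm.ball r n).card : ℝ) := by
    have e1 : (s ^ 2) ^ (-(n : ℝ)) = ((s ^ 2) ^ n)⁻¹ := by
      rw [Real.rpow_neg (by positivity), Real.rpow_natCast]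
    have e0 : ∀ y : ℝ, (s ^ 2) ^ (y / 2) = s ^ y := by
      intro y
      rw [← Real.rpow_natCast s 2, ← Real.rpow_mul hs0.le]
      congr 1; push_cast; ring
    have e2 : (s ^ 2) ^ (-(1 : ℝ) / 2) = s⁻¹ := by
      rw [e0, Real.rpow_neg_one]
    have e3 : (s ^ 2) ^ (-(n : ℝ) / 2) = (s ^ n)⁻¹ := by
      rw [e0, Real.rpow_neg hs0.le, Real.rpow_natCast]
    rw [e1, e2, e3, hcard, BallNorm.beta]
    have hS : 0 ≤ ∑ k ∈ Finset.range n, (s ^ 2) ^ k := by positivity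
    generalize ∑ k ∈ Finset.range n, (s ^ 2) ^ k = S at hS
    have e4 : 1 + 2 * ((s ^ 2) ^ n)⁻¹ * S = ((s ^ 2) ^ n + 2 * S) / (s ^ n) ^ 2 := by
      field_simp
      ring
    have : 0 < (s ^ 2) ^ n + 2 * S := by positivity
    rw [e4]
    field_simp
    ring
  rw [hrhs]
  have hval : ∀ f : FreeGroup (Fin r) → ℂ, l2Norm (fun x =>
      (∑ γ ∈ BallNorm.ball r n, f (x * γ)) / ((BallNorm.ball r n).card : ℂ)) =
      l2Norm (BallNorm.opB r n f) / ((BallNorm.ball r n).card : ℝ) := by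
    intro f
    have : (fun x => (∑ γ ∈ BallNorm.ball r n, f (x * γ)) / ((BallNorm.ball r n).card : ℂ)) =
        fun x => ((BallNorm.ball r n).card : ℂ)⁻¹ * BallNorm.opB r n f x := by
      funext x; rw [BallNorm.opB, inv_mul_eq_div]
    rw [this, BallNorm.l2Norm_smul, norm_inv, Complex.norm_natCast, inv_mul_eq_div]
  apply csSup_eq_of_forall_le_of_forall_lt_exists_gt
  · obtain ⟨f, h1, h2, _⟩ := BallNorm.lower r s hs hsq n _ (sub_one_lt _)
    exact ⟨_, f, h1, h2, rfl⟩
  · rintro ρ ⟨f, h1, h2, rfl⟩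
    rw [hval]
    have := BallNorm.upper r s hs hsq n h1
    rw [h2, mul_one] at this
    gcongr
  · intro w hw
    rw [lt_div_iff₀ hcpos] at hw
    obtain ⟨f, h1, h2, h3⟩ := BallNorm.lower r s hs hsq n _ hw
    refine ⟨_, ⟨f, h1, h2, rfl⟩, ?_⟩
    rw [hval, lt_div_iff₀ hcpos]
    exact h3

end
end

section
/- Let p be a prime with p ≡ 1 (mod 4). Then the set {(x₀,x₁,x₂,x₃) ∈ ℤ⁴ : x₀² + x₁² + x₂² + x₃² = p, x₀ > 0, x₀ odd} has exactly p+1 elements. -/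
namespace LipCount

/-- The left ideal attached to the vector `(s,t)`: the matrix of `a+bi+cj+dk` mod `p` kills it. -/
def L (p : ℕ) (I s t : ZMod p) (a b c d : ℤ) : Prop :=
  ((a : ZMod p) + b * I) * s + (c + d * I) * t = 0 ∧
  (-(c : ZMod p) + d * I) * s + (a - b * I) * t = 0

lemma L_mul {p : ℕ} {I s t : ZMod p} (hI : I * I = -1) {a b c d : ℤ} (h : L p I s t a b c d)
    (x y z w : ℤ) :
    L p I s t (x*a - y*b - z*c - w*d) (x*b + y*a + z*d - w*c)
      (x*c - y*d + z*a + w*b) (x*d + y*c - z*b + w*a) := by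
  obtain ⟨h1, h2⟩ := h
  constructor
  · push_cast
    linear_combination ((x:ZMod p) + y*I) * h1 + ((z:ZMod p) + w * I) * h2
      - ((y:ZMod p)*b*s + y*d*t + w*d*s - w*b*t) * hI
  · push_cast
    linear_combination (-(z:ZMod p) + w*I) * h1 + ((x:ZMod p) - y * I) * h2
      - (-(y:ZMod p)*d*s + y*b*t + w*b*s + w*d*t) * hI

lemma L_div {p : ℕ} [Fact p.Prime] {I s t : ZMod p} {m a b c d : ℤ} (hm : (m : ZMod p) ≠ 0)
    (h : L p I s t (m*a) (m*b) (m*c) (m*d)) : L p I s t a b c d := by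
  obtain ⟨h1, h2⟩ := h
  push_cast at h1 h2
  constructor
  · apply mul_left_cancel₀ hm
    linear_combination h1
  · apply mul_left_cancel₀ hm
    linear_combination h2

lemma descend {p : ℕ} [Fact p.Prime] {I s t : ZMod p} (hI : I * I = -1) {m : ℤ} {a b c d : ℤ}
    (hm : (m : ZMod p) ≠ 0)
    (h : L p I s t a b c d) (hN : a^2+b^2+c^2+d^2 = m * p) (x y z w x' y' z' w' : ℤ)
    (ha : a = x + m * x') (hb : b = y + m * y') (hc : c = z + m * z') (hd : d = w + m * w')
    (hβ : x^2+y^2+z^2+w^2 = m) :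
    ∃ a b c d : ℤ, L p I s t a b c d ∧ a^2+b^2+c^2+d^2 = p := by
  have hm0 : m ≠ 0 := by rintro rfl; simp at hm
  have key := L_mul hI h x (-y) (-z) (-w)
  refine ⟨1 + (x*x' + y*y' + z*z' + w*w'), x*y' - y*x' - z*w' + w*z',
    x*z' + y*w' - z*x' - w*y', x*w' - y*z' + z*y' - w*x', L_div hm ?_, ?_⟩
  · convert key using 1
    · subst ha hb hc hd; linear_combination -hβ
    · subst ha hb hc hd; ring
    · subst ha hb hc hd; ring
    · subst ha hb hc hd; ring
  · apply mul_left_cancel₀ (mul_ne_zero hm0 hm0)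
    have e : (x^2+y^2+z^2+w^2) * (a^2+b^2+c^2+d^2) = m * (m * p) := by rw [hβ, hN]
    have e1 : m * (1 + (x*x' + y*y' + z*z' + w*w')) = x*a+y*b+z*c+w*d := by
      subst ha hb hc hd; linear_combination -hβ
    have e2 : m * (x*y' - y*x' - z*w' + w*z') = x*b-y*a-z*d+w*c := by
      subst ha hb hc hd; ring
    have e3 : m * (x*z' + y*w' - z*x' - w*y') = x*c+y*d-z*a-w*b := by
      subst ha hb hc hd; ring
    have e4 : m * (x*w' - y*z' + z*y' - w*x') = x*d-y*c+z*b-w*a := by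
      subst ha hb hc hd; ring
    calc _ = (m * (1 + (x*x' + y*y' + z*z' + w*w')))^2 + (m * (x*y' - y*x' - z*w' + w*z'))^2
          + (m * (x*z' + y*w' - z*x' - w*y'))^2 + (m * (x*w' - y*z' + z*y' - w*x'))^2 := by ring
      _ = _ := by rw [e1, e2, e3, e4]; linear_combination e

lemma mod2 (a : ℤ) : ∃ x x' : ℤ, a = x + 2 * x' ∧ 0 ≤ x^2 ∧ x^2 ≤ 1 ∧ ∃ k, a^2 = x^2 + 4 * k := by
  refine ⟨a % 2, a / 2, by omega, by positivity, ?_, ?_⟩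
  · rcases Int.emod_two_eq_zero_or_one a with h | h <;> simp [h]
  · refine ⟨(a/2)^2 + (a%2)*(a/2), ?_⟩
    have : a = a % 2 + 2 * (a/2) := by omega
    generalize a % 2 = x at *
    generalize a / 2 = y at *
    subst this; ring

lemma mod3 (a : ℤ) : ∃ x x' : ℤ, a = x + 3 * x' ∧ 0 ≤ x^2 ∧ x^2 ≤ 1 ∧ (x = 0 ∨ x^2 = 1)
    ∧ ∃ k, a^2 = x^2 + 3 * k := by
  have : ∃ x x' : ℤ, a = x + 3 * x' ∧ (x = 0 ∨ x = 1 ∨ x = -1) :=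
    ⟨(a+1) % 3 - 1, (a+1)/3, by omega, by omega⟩
  obtain ⟨x, x', h, hx⟩ := this
  refine ⟨x, x', h, by positivity, ?_, ?_, 2*x*x' + 3*x'^2, by rw [h]; ring⟩
  · rcases hx with rfl | rfl | rfl <;> norm_num
  · rcases hx with rfl | rfl | rfl <;> norm_num

lemma L_norm {p : ℕ} [Fact p.Prime] {I s t : ZMod p} (hI : I * I = -1) (hst : s ≠ 0 ∨ t ≠ 0)
    {a b c d : ℤ} (h : L p I s t a b c d) : (p : ℤ) ∣ a^2+b^2+c^2+d^2 := by
  rw [← ZMod.intCast_zmod_eq_zero_iff_dvd]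
  · obtain ⟨h1, h2⟩ := h
    push_cast
    rcases hst with h | h <;> apply mul_right_cancel₀ h
    · linear_combination ((a:ZMod p) - b * I) * h1 - (c + d * I) * h2 + ((b:ZMod p)^2 + d^2)*s*hI
    · linear_combination -(-(c:ZMod p) + d * I) * h1 + (a + b * I) * h2 + ((b:ZMod p)^2 + d^2)*t*hI

lemma small {p : ℕ} [hp : Fact p.Prime] (I s t : ZMod p) :
    ∃ a b c d : ℤ, L p I s t a b c d ∧ 0 < a^2+b^2+c^2+d^2 ∧ a^2+b^2+c^2+d^2 < 4 * p := by
  set n := Nat.sqrt p with hn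
  have hlt : n * n < p := by
    refine lt_of_le_of_ne (Nat.sqrt_le p) fun h => ?_
    exact (Nat.prime_mul_iff.not.mpr (by
      rintro (⟨h1, h2⟩ | ⟨h1, h2⟩) <;> (rw [h2] at h1; exact Nat.not_prime_one h1))) (h ▸ hp.out)
  have hgt : p < (n+1) * (n+1) := Nat.lt_succ_sqrt p
  let F := Fin (n+1)
  let f : F × F × F × F → ZMod p × ZMod p := fun x =>
    ((((x.1 : ℕ) : ZMod p) + (x.2.1 : ℕ) * I) * s + ((x.2.2.1 : ℕ) + (x.2.2.2 : ℕ) * I) * t,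
     (-((x.2.2.1 : ℕ) : ZMod p) + (x.2.2.2 : ℕ) * I) * s + ((x.1 : ℕ) - (x.2.1 : ℕ) * I) * t)
  have hc : Fintype.card (ZMod p × ZMod p) < Fintype.card (F × F × F × F) := by
    simp only [Fintype.card_prod, ZMod.card, F, Fintype.card_fin]
    calc p * p < ((n+1)*(n+1)) * ((n+1)*(n+1)) := Nat.mul_lt_mul'' hgt hgt
      _ = _ := by ring
  obtain ⟨x, y, hxy, hf⟩ := Fintype.exists_ne_map_eq_of_card_lt f hc
  obtain ⟨x0, x1, x2, x3⟩ := x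
  obtain ⟨y0, y1, y2, y3⟩ := y
  simp only [f, Prod.mk.injEq] at hf
  have bd : ∀ u v : F, (((u:ℕ):ℤ) - ((v:ℕ):ℤ))^2 ≤ n * n := by
    intro u v
    have hu := u.is_lt
    have hv := v.is_lt
    have : |((u:ℕ):ℤ) - ((v:ℕ):ℤ)| ≤ n := by rw [abs_le]; omega
    rw [← sq_abs, sq]
    gcongr
  have hlt' : (n:ℤ) * n < p := by exact_mod_cast hlt
  refine ⟨((x0:ℕ):ℤ) - ((y0:ℕ):ℤ), ((x1:ℕ):ℤ) - ((y1:ℕ):ℤ), ((x2:ℕ):ℤ) - ((y2:ℕ):ℤ),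
    ((x3:ℕ):ℤ) - ((y3:ℕ):ℤ), ⟨?_, ?_⟩, ?_, ?_⟩
  · push_cast; linear_combination hf.1
  · push_cast; linear_combination hf.2
  · by_contra hcon
    apply hxy
    have z : ∀ u v : F, (((u:ℕ):ℤ) - ((v:ℕ):ℤ))^2 ≤ 0 → u = v := by
      intro u v h
      have := pow_eq_zero_iff (two_ne_zero) |>.1 (le_antisymm h (sq_nonneg _))
      apply Fin.ext; omega
    have h0 := sq_nonneg (((x0:ℕ):ℤ) - ((y0:ℕ):ℤ))
    have h1 := sq_nonneg (((x1:ℕ):ℤ) - ((y1:ℕ):ℤ))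
    have h2 := sq_nonneg (((x2:ℕ):ℤ) - ((y2:ℕ):ℤ))
    have h3 := sq_nonneg (((x3:ℕ):ℤ) - ((y3:ℕ):ℤ))
    rw [z x0 y0 (by linarith), z x1 y1 (by linarith), z x2 y2 (by linarith), z x3 y3 (by linarith)]
  · linarith [bd x0 y0, bd x1 y1, bd x2 y2, bd x3 y3]

lemma natCast_small_ne {p : ℕ} (hp : p.Prime) (hp4 : p % 4 = 1) (m : ℕ) (h0 : 0 < m) (h : m < 4) :
    ((m : ℤ) : ZMod p) ≠ 0 := by
  have h5 : 5 ≤ p := by have := hp.two_le; omega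
  rw [Int.cast_natCast, Ne, ZMod.natCast_eq_zero_iff]
  exact fun hd => by have := Nat.le_of_dvd h0 hd; omega

lemma exists_norm {p : ℕ} [hp : Fact p.Prime] (hp4 : p % 4 = 1) {I s t : ZMod p} (hI : I * I = -1)
    (hst : s ≠ 0 ∨ t ≠ 0) : ∃ a b c d : ℤ, L p I s t a b c d ∧ a^2+b^2+c^2+d^2 = p := by
  obtain ⟨a, b, c, d, h, hpos, hlt⟩ := small I s t
  obtain ⟨m, hm⟩ := L_norm hI hst h
  have hp0 : (0:ℤ) < p := by exact_mod_cast hp.out.pos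
  have m0 : 0 < m := by rw [hm] at hpos; exact pos_of_mul_pos_right hpos hp0.le
  have m4 : m < 4 := by rw [hm] at hlt; nlinarith
  obtain rfl | rfl | rfl : m = 1 ∨ m = 2 ∨ m = 3 := by omega
  · exact ⟨a, b, c, d, h, by linarith⟩
  · obtain ⟨x, x', ha, hx0, hx1, k1, e1⟩ := mod2 a
    obtain ⟨y, y', hb, hy0, hy1, k2, e2⟩ := mod2 b
    obtain ⟨z, z', hc, hz0, hz1, k3, e3⟩ := mod2 c
    obtain ⟨w, w', hd, hw0, hw1, k4, e4⟩ := mod2 d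
    exact descend hI (natCast_small_ne hp.out hp4 2 (by norm_num) (by norm_num)) h
      (by rw [hm]; push_cast; ring) x y z w x' y' z' w' ha hb hc hd (by push_cast; omega)
  · obtain ⟨x, x', ha, hx0, hx1, hx, k1, e1⟩ := mod3 a
    obtain ⟨y, y', hb, hy0, hy1, hy, k2, e2⟩ := mod3 b
    obtain ⟨z, z', hc, hz0, hz1, hz, k3, e3⟩ := mod3 c
    obtain ⟨w, w', hd, hw0, hw1, hw, k4, e4⟩ := mod3 d
    refine descend hI (natCast_small_ne hp.out hp4 3 (by norm_num) (by norm_num)) h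
      (by rw [hm]; push_cast; ring) x y z w x' y' z' w' ha hb hc hd ?_
    have hcase : x^2+y^2+z^2+w^2 = 0 ∨ x^2+y^2+z^2+w^2 = 3 := by omega
    rcases hcase with h0 | h0
    · exfalso
      have x0 : x = 0 := by rcases hx with h | h; exacts [h, by omega]
      have y0 : y = 0 := by rcases hy with h | h; exacts [h, by omega]
      have z0 : z = 0 := by rcases hz with h | h; exacts [h, by omega]
      have w0 : w = 0 := by rcases hw with h | h; exacts [h, by omega]
      subst x0 y0 z0 w0
      have : (p:ℤ) = 3 * (x'^2+y'^2+z'^2+w'^2) := by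
        subst ha hb hc hd; linarith
      have h3 : 3 ∣ p := by exact_mod_cast Dvd.intro _ this.symm
      have := (Nat.prime_dvd_prime_iff_eq Nat.prime_three hp.out).1 h3
      omega
    · exact_mod_cast h0

lemma sq_mod4 (a : ℤ) : (a % 2 = 0 ∧ a^2 % 4 = 0) ∨ (a % 2 = 1 ∧ a^2 % 4 = 1) := by
  rcases Int.even_or_odd' a with ⟨k, rfl | rfl⟩
  · left; refine ⟨by omega, ?_⟩; ring_nf; omega
  · right; refine ⟨by omega, ?_⟩; ring_nf; omega

/-- The target set. -/
def S (p : ℕ) : Set (ℤ × ℤ × ℤ × ℤ) := { x : ℤ × ℤ × ℤ × ℤ |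
      x.1 ^ 2 + x.2.1 ^ 2 + x.2.2.1 ^ 2 + x.2.2.2 ^ 2 = (p : ℤ) ∧
      0 < x.1 ∧ Odd x.1 }

lemma exists_first_pos {p : ℕ} {I s t : ZMod p} (hI : I * I = -1) {a b c d : ℤ}
    (h : L p I s t a b c d) (hN : a^2+b^2+c^2+d^2 = p) (ho : a % 2 = 1) :
    ∃ x ∈ S p, L p I s t x.1 x.2.1 x.2.2.1 x.2.2.2 := by
  rcases lt_trichotomy a 0 with h0 | h0 | h0
  · refine ⟨(-a, -b, -c, -d), ⟨by simpa using hN, by simpa using h0,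
      by simpa using Int.odd_iff.2 ho⟩, ?_⟩
    convert L_mul hI h (-1) 0 0 0 using 1 <;> ring
  · omega
  · exact ⟨(a, b, c, d), ⟨hN, h0, Int.odd_iff.2 ho⟩, h⟩

lemma exists_S {p : ℕ} [hp : Fact p.Prime] (hp4 : p % 4 = 1) {I s t : ZMod p} (hI : I * I = -1)
    (hst : s ≠ 0 ∨ t ≠ 0) : ∃ x ∈ S p, L p I s t x.1 x.2.1 x.2.2.1 x.2.2.2 := by
  obtain ⟨a, b, c, d, h, hN⟩ := exists_norm hp4 hI hst
  have := sq_mod4 a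
  have := sq_mod4 b
  have := sq_mod4 c
  have := sq_mod4 d
  have : a % 2 = 1 ∨ b % 2 = 1 ∨ c % 2 = 1 ∨ d % 2 = 1 := by omega
  rcases this with ho | ho | ho | ho
  · exact exists_first_pos hI h hN ho
  · exact exists_first_pos hI (L_mul hI h 0 (-1) 0 0) (by linear_combination hN)
      (by ring_nf; exact ho)
  · exact exists_first_pos hI (L_mul hI h 0 0 (-1) 0) (by linear_combination hN)
      (by ring_nf; exact ho)
  · exact exists_first_pos hI (L_mul hI h 0 0 0 (-1)) (by linear_combination hN)
      (by ring_nf; exact ho)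

lemma S_parity {p : ℕ} (hp4 : p % 4 = 1) {a b c d : ℤ} (h : (a, b, c, d) ∈ S p) :
    Odd a ∧ Even b ∧ Even c ∧ Even d := by
  obtain ⟨hN, -, ho⟩ := h
  simp only at hN ho
  have := Int.odd_iff.1 ho
  have := sq_mod4 a
  have := sq_mod4 b
  have := sq_mod4 c
  have := sq_mod4 d
  refine ⟨ho, ?_, ?_, ?_⟩ <;> rw [Int.even_iff] <;> omega

lemma unique_S {p : ℕ} [hp : Fact p.Prime] (hp4 : p % 4 = 1) {I s t : ZMod p} (hI : I * I = -1)
    (hst : s ≠ 0 ∨ t ≠ 0) {x y : ℤ × ℤ × ℤ × ℤ} (hx : x ∈ S p) (hy : y ∈ S p)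
    (hLx : L p I s t x.1 x.2.1 x.2.2.1 x.2.2.2) (hLy : L p I s t y.1 y.2.1 y.2.2.1 y.2.2.2) :
    x = y := by
  obtain ⟨a, b, c, d⟩ := x
  obtain ⟨a', b', c', d'⟩ := y
  obtain ⟨o1, o2, o3, o4⟩ := S_parity hp4 hx
  obtain ⟨q1, q2, q3, q4⟩ := S_parity hp4 hy
  obtain ⟨hN, ha, -⟩ := hx
  obtain ⟨hN', ha', -⟩ := hy
  obtain ⟨h1, h2⟩ := hLx
  obtain ⟨h3, h4⟩ := hLy
  simp only at *
  set g := a*a' + b*b' + c*c' + d*d' with hg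
  have godd : Odd g := ((o1.mul q1).add_even (o2.mul_right _)).add_even (o3.mul_right _)
    |>.add_even (o4.mul_right _)
  have two := natCast_small_ne hp.out hp4 2 (by norm_num) (by norm_num)
  push_cast at two
  have hdvd : (p:ℤ) ∣ g := by
    rw [← ZMod.intCast_zmod_eq_zero_iff_dvd]
    apply mul_left_cancel₀ two
    rw [hg]
    push_cast
    rcases hst with h | h <;> apply mul_right_cancel₀ h
    · linear_combination ((a':ZMod p) - b' * I) * h1 - (c' + d' * I) * h2
        + ((a:ZMod p) - b * I) * h3 - (c + d * I) * h4 + 2 * ((b:ZMod p)*b' + d*d')*s*hI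
    · linear_combination -(-(c':ZMod p) + d' * I) * h1 + (a' + b' * I) * h2
        -(-(c:ZMod p) + d * I) * h3 + (a + b * I) * h4 + 2 * ((b:ZMod p)*b' + d*d')*t*hI
  have g0 : g ≠ 0 := by rintro h; rw [h] at godd; exact absurd godd (by decide)
  rcases lt_or_gt_of_ne g0 with hneg | hpos
  · exfalso
    have := Int.le_of_dvd (by linarith) ((dvd_neg).2 hdvd)
    nlinarith [sq_nonneg (b+b'), sq_nonneg (c+c'), sq_nonneg (d+d'), mul_pos ha ha',
      sq_nonneg a, sq_nonneg a', pow_pos ha 2]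
  · have := Int.le_of_dvd hpos hdvd
    have e : (a-a')^2 + (b-b')^2 + (c-c')^2 + (d-d')^2 ≤ 0 := by nlinarith
    have f1 := sq_nonneg (a-a')
    have f2 := sq_nonneg (b-b')
    have f3 := sq_nonneg (c-c')
    have f4 := sq_nonneg (d-d')
    have z : ∀ u v : ℤ, (u-v)^2 ≤ 0 → u = v := fun u v h => by
      have := pow_eq_zero_iff (two_ne_zero) |>.1 (le_antisymm h (sq_nonneg _))
      omega
    rw [z a a' (by linarith), z b b' (by linarith), z c c' (by linarith), z d d' (by linarith)]

/-- First coordinate of the representative of a point of the projective line. -/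
def vs {p : ℕ} : Option (ZMod p) → ZMod p
  | none => 1
  | some u => u

/-- Second coordinate of the representative of a point of the projective line. -/
def vt {p : ℕ} : Option (ZMod p) → ZMod p
  | none => 0
  | some _ => 1

lemma v_ne {p : ℕ} [Fact p.Prime] (o : Option (ZMod p)) : vs o ≠ 0 ∨ vt o ≠ 0 := by
  cases o <;> simp [vs, vt]

lemma v_inj {p : ℕ} [Fact p.Prime] (o o' : Option (ZMod p)) (h : vs o * vt o' - vs o' * vt o = 0) :
    o = o' := by
  cases o <;> cases o' <;> simp_all [vs, vt, sub_eq_zero]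

lemma L_vec {p : ℕ} [hp : Fact p.Prime] (hp4 : p % 4 = 1) {I s t s' t' : ZMod p} (hI : I * I = -1)
    {x : ℤ × ℤ × ℤ × ℤ} (hx : x ∈ S p)
    (h : L p I s t x.1 x.2.1 x.2.2.1 x.2.2.2) (h' : L p I s' t' x.1 x.2.1 x.2.2.1 x.2.2.2) :
    s * t' - s' * t = 0 := by
  obtain ⟨a, b, c, d⟩ := x
  obtain ⟨h1, h2⟩ := h
  obtain ⟨h3, h4⟩ := h'
  obtain ⟨hN, -, -⟩ := hx
  simp only at *
  by_contra hD
  have two := natCast_small_ne hp.out hp4 2 (by norm_num) (by norm_num)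
  push_cast at two
  have I0 : I ≠ 0 := by rintro rfl; simp at hI
  have m1 : (a : ZMod p) + b * I = 0 := by
    apply mul_right_cancel₀ hD; linear_combination t' * h1 - t * h3
  have m2 : (c : ZMod p) + d * I = 0 := by
    apply mul_right_cancel₀ hD; linear_combination s * h3 - s' * h1
  have m3 : -(c : ZMod p) + d * I = 0 := by
    apply mul_right_cancel₀ hD; linear_combination t' * h2 - t * h4
  have m4 : (a : ZMod p) - b * I = 0 := by
    apply mul_right_cancel₀ hD; linear_combination s * h4 - s' * h2
  have fin : ∀ u : ℤ, (u : ZMod p) = 0 → (p:ℤ)^2 ∣ u^2 := fun u hu =>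
    pow_dvd_pow_of_dvd ((ZMod.intCast_zmod_eq_zero_iff_dvd u p).1 hu) 2
  have da := fin a (by apply mul_left_cancel₀ two; linear_combination m1 + m4)
  have dc := fin c (by apply mul_left_cancel₀ two; linear_combination m2 - m3)
  have db := fin b (by apply mul_left_cancel₀ (mul_ne_zero two I0); linear_combination m1 - m4)
  have dd := fin d (by apply mul_left_cancel₀ (mul_ne_zero two I0); linear_combination m2 + m3)
  have := dvd_add (dvd_add (dvd_add da db) dc) dd
  rw [hN] at this
  have h2 : p^2 ∣ p := by exact_mod_cast this
  have := Nat.le_of_dvd hp.out.pos h2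
  nlinarith [hp.out.two_le]

lemma exists_v {p : ℕ} [hp : Fact p.Prime] {I : ZMod p} (hI : I * I = -1)
    {x : ℤ × ℤ × ℤ × ℤ} (hx : x ∈ S p) :
    ∃ o : Option (ZMod p), L p I (vs o) (vt o) x.1 x.2.1 x.2.2.1 x.2.2.2 := by
  obtain ⟨a, b, c, d⟩ := x
  obtain ⟨hN, -, -⟩ := hx
  simp only at *
  have hdet : (a:ZMod p)^2+(b:ZMod p)^2+(c:ZMod p)^2+(d:ZMod p)^2 = 0 := by
    have := congrArg (fun z : ℤ => (z : ZMod p)) hN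
    push_cast at this
    simpa using this
  by_cases k1 : (a : ZMod p) + b * I = 0
  · by_cases k2 : -(c : ZMod p) + d * I = 0
    · exact ⟨none, by simp [L, vs, vt, k1, k2]⟩
    · refine ⟨some (-(a - b * I) / (-c + d * I)), ?_, ?_⟩
      · simp only [vs, vt]
        rw [k1]
        apply mul_right_cancel₀ k2
        linear_combination (-1:ZMod p) * hdet + ((a:ZMod p) - b * I) * k1
          + ((b:ZMod p)^2 + d^2) * hI
      · simp only [vs, vt]
        field_simp
        ring
  · refine ⟨some (-(c + d * I) / (a + b * I)), ?_, ?_⟩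
    · simp only [vs, vt]
      field_simp
      ring
    · simp only [vs, vt]
      apply mul_right_cancel₀ k1
      have e : -((c : ZMod p) + d * I) / (a + b * I) * (a + b * I) = -(c + d * I) :=
        div_mul_cancel₀ _ k1
      linear_combination (-(c : ZMod p) + d * I) * e + hdet - ((b:ZMod p)^2 + d^2) * hI

end LipCount

open LipCount in
/-- **Jacobi's count of Lipschitz quaternions of prime norm `p ≡ 1 (mod 4)` with positive
odd first coordinate.** For a prime `p ≡ 1 (mod 4)`, there are exactly `p + 1` integer
solutions `(x₀,x₁,x₂,x₃)` of `x₀² + x₁² + x₂² + x₃² = p` with `x₀ > 0` and `x₀` odd. -/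
theorem count_lipschitz_quaternions (p : ℕ) (hp : p.Prime) (hp4 : p % 4 = 1) :
    Set.ncard { x : ℤ × ℤ × ℤ × ℤ |
      x.1 ^ 2 + x.2.1 ^ 2 + x.2.2.1 ^ 2 + x.2.2.2 ^ 2 = (p : ℤ) ∧
      0 < x.1 ∧ Odd x.1 } = p + 1 := by
  change (S p).ncard = p + 1
  haveI : Fact p.Prime := ⟨hp⟩
  obtain ⟨I, hI'⟩ := (ZMod.exists_sq_eq_neg_one_iff (p := p)).2 (by omega)
  have hI : I * I = -1 := hI'.symm
  choose f hfS hfL using fun o : Option (ZMod p) => exists_S hp4 hI (v_ne o)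
  have hinj : Function.Injective f := by
    intro o o' h
    exact v_inj o o' (L_vec hp4 hI (hfS o) (hfL o) (by rw [h]; exact hfL o'))
  have hrange : Set.range f = S p := by
    ext x
    constructor
    · rintro ⟨o, rfl⟩; exact hfS o
    · intro hx
      obtain ⟨o, ho⟩ := exists_v hI hx
      exact ⟨o, unique_S hp4 hI (v_ne o) (hfS o) hx (hfL o) ho⟩
  rw [← hrange, ← Set.image_univ, Set.ncard_image_of_injective _ hinj, Set.ncard_univ,
    Nat.card_eq_fintype_card, Fintype.card_option, ZMod.card]
end
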